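/- arXiv:2410.11220 — 14 statements merged into one kernel-verified Lean document; each statement's English description precedes it below -/
import Mathlib

section
/- For a function F : 2^{[n]} → ℝ, define its multisymmetric lift F̂ on the n-element subsets of [2n] by F̂(T) = F(T ∩ [n]). Then F is M♮-concave if and only if F̂ lies in the Dressian Dr(n,2n). -/
open Finset

/-- M♮-concavity of a function on subsets of the ground set `{0, ..., n-1}`. -/
def MNatConcaveOn (n : ℕ) (F : Finset ℕ → ℝ) : Prop :=
  ∀ S ⊆ Finset.range n, ∀ T ⊆ Finset.range n, ∀ i ∈ S, i ∉ T →
    (F S + F T ≤ F (S.erase i) + F (insert i T) ∨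
      ∃ j ∈ T, j ∉ S ∧
        F S + F T ≤ F (insert j (S.erase i)) + F ((insert i T).erase j))

/-- The maximum of `f` over the finite set `s` is attained at least twice. -/
def MaxAttainedTwice {α : Type*} (s : Finset α) (f : α → ℝ) : Prop :=
  ∃ i ∈ s, ∃ j ∈ s, i ≠ j ∧ f i = f j ∧ ∀ l ∈ s, f l ≤ f i

/-- `p` (viewed as a function on the `k`-element subsets of the ground set
`{0, ..., m-1}`) lies in the Dressian `Dr(k, m)`. -/
def InDressian (k m : ℕ) (p : Finset ℕ → ℝ) : Prop :=
  ∀ S ⊆ Finset.range m, S.card = k - 1 → ∀ T ⊆ Finset.range m, T.card = k + 1 →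
    MaxAttainedTwice (T \ S) (fun i => p (insert i S) + p (T.erase i))

lemma aux_ultra (ab ac ad bc bd cd : ℝ)
    (h1 : ab ≤ ac ∨ ab ≤ bc) (h2 : ab ≤ ad ∨ ab ≤ bd)
    (h3 : cd ≤ ac ∨ cd ≤ ad) (h4 : cd ≤ bc ∨ cd ≤ bd) :
    ab + cd ≤ ac + bd ∨ ab + cd ≤ ad + bc := by
  by_contra! h
  obtain ⟨h5, h6⟩ := h
  rcases h1 with h1 | h1 <;> rcases h2 with h2 | h2 <;> rcases h3 with h3 | h3 <;>
    rcases h4 with h4 | h4 <;> linarith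

/-- the three-term exchange property -/
def LocalEx (p : Finset ℕ → ℝ) : Prop :=
  ∀ (C : Finset ℕ) (a b c d : ℕ), a ∉ C → b ∉ C → c ∉ C → d ∉ C →
    a ≠ b → a ≠ c → a ≠ d → b ≠ c → b ≠ d → c ≠ d →
    p (insert a (insert b C)) + p (insert c (insert d C)) ≤
        p (insert a (insert c C)) + p (insert b (insert d C)) ∨
    p (insert a (insert b C)) + p (insert c (insert d C)) ≤
        p (insert a (insert d C)) + p (insert b (insert c C))

lemma exch_of_local (p : Finset ℕ → ℝ) (hp : LocalEx p) (k : ℕ) :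
    ∀ (A B : Finset ℕ), A.card = B.card → (A \ B).card = k + 1 → ∀ i ∈ A, i ∉ B →
      ∃ j ∈ B, j ∉ A ∧ p A + p B ≤ p (insert j (A.erase i)) + p (insert i (B.erase j)) := by
  induction k with
  | zero =>
    intro A B hc h1 i hi hi'
    have h2 : (B \ A).card = 1 := by
      rw [← Finset.card_sdiff_comm hc, h1]
    obtain ⟨x, hx⟩ := Finset.card_eq_one.1 h1
    obtain ⟨j, hj⟩ := Finset.card_eq_one.1 h2
    have hx' : ∀ t, t ∈ A ∧ t ∉ B ↔ t = x := by
      intro t; rw [← Finset.mem_sdiff, hx, Finset.mem_singleton]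
    have hj' : ∀ t, t ∈ B ∧ t ∉ A ↔ t = j := by
      intro t; rw [← Finset.mem_sdiff, hj, Finset.mem_singleton]
    have hix := (hx' i).1 ⟨hi, hi'⟩
    subst hix
    have hjj := (hj' j).2 rfl
    refine ⟨j, hjj.1, hjj.2, ?_⟩
    have e1 : insert j (A.erase i) = B := by
      ext t
      have := hx' t; have := hj' t
      simp only [Finset.mem_insert, Finset.mem_erase]
      grind
    have e2 : insert i (B.erase j) = A := by
      ext t
      have := hx' t; have := hj' t
      simp only [Finset.mem_insert, Finset.mem_erase]
      grind
    rw [e1, e2]; linarith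
  | succ k ih =>
    intro A B hc h1 i hi hi'
    by_contra! hcon
    have h2 : (B \ A).card = k + 1 + 1 := by
      rw [← Finset.card_sdiff_comm hc, h1]
    obtain ⟨u, hu, hui⟩ := Finset.exists_mem_ne (s := A \ B) (by omega) i
    rw [Finset.mem_sdiff] at hu
    have hne : (B \ A).Nonempty := Finset.card_pos.1 (by omega)
    obtain ⟨v, hv, hmax⟩ := Finset.exists_max_image (B \ A)
      (fun v => p (insert u (B.erase v)) + p (insert v (A.erase i))) hne
    rw [Finset.mem_sdiff] at hv
    have hc2 : A.card = (insert u (B.erase v)).card := by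
      rw [Finset.card_insert_of_notMem (by simp [hu.2]), Finset.card_erase_add_one hv.1, hc]
    have hd : (A \ insert u (B.erase v)).card = k + 1 := by
      have : A \ insert u (B.erase v) = (A \ B).erase u := by
        ext t; simp only [Finset.mem_sdiff, Finset.mem_insert, Finset.mem_erase]
        grind
      rw [this, Finset.card_erase_of_mem (by simp [hu]), h1]; rfl
    obtain ⟨j, hjB, hjA, hj⟩ := ih A _ hc2 hd i hi (by
      simp only [Finset.mem_insert, Finset.mem_erase]; grind)
    have hju : j ≠ u := by rintro rfl; exact hjA hu.1
    have hj2 : j ≠ v ∧ j ∈ B := by simpa [hju] using hjB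
    have m := hmax j (by simp [hj2.2, hjA])
    have c1 := hcon j hj2.2 hjA
    have c2 := hcon v hv.1 hv.2
    have L := hp ((B.erase v).erase j) u i v j (by simp [hu.2]) (by simp [hi']) (by simp) (by simp)
      hui (by rintro rfl; exact hv.2 hu.1) hju.symm (by rintro rfl; exact hv.2 hi)
      (by rintro rfl; exact hjA hi) hj2.1.symm
    have hjv : j ≠ v := hj2.1
    have hjB' := hj2.2
    obtain ⟨hvB, hvA⟩ := hv
    obtain ⟨huA, huB⟩ := hu
    have e1 : insert u (insert i ((B.erase v).erase j)) =
        insert i ((insert u (B.erase v)).erase j) := by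
      ext t; simp only [Finset.mem_insert, Finset.mem_erase]; grind
    have e2 : insert v (insert j ((B.erase v).erase j)) = B := by
      ext t; simp only [Finset.mem_insert, Finset.mem_erase]; grind
    have e3 : insert u (insert v ((B.erase v).erase j)) = insert u (B.erase j) := by
      ext t; simp only [Finset.mem_insert, Finset.mem_erase]; grind
    have e4 : insert i (insert j ((B.erase v).erase j)) = insert i (B.erase v) := by
      ext t; simp only [Finset.mem_insert, Finset.mem_erase]; grind
    have e5 : insert u (insert j ((B.erase v).erase j)) = insert u (B.erase v) := by
      ext t; simp only [Finset.mem_insert, Finset.mem_erase]; grind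
    have e6 : insert i (insert v ((B.erase v).erase j)) = insert i (B.erase j) := by
      ext t; simp only [Finset.mem_insert, Finset.mem_erase]; grind
    rw [e1, e2, e3, e4, e5, e6] at L
    rcases L with L | L <;> linarith

lemma mn_two {n : ℕ} {F : Finset ℕ → ℝ} (h : MNatConcaveOn n F) (X : Finset ℕ)
    (hX : X ⊆ range n) {a b : ℕ} (ha : a ∈ range n) (hb : b ∈ range n)
    (haX : a ∉ X) (hab : a ≠ b) :
    F (insert a (insert b X)) + F X ≤ F (insert a X) + F (insert b X) := by
  have := h (insert a (insert b X)) (by simp only [insert_subset_iff]; exact ⟨ha, hb, hX⟩) X hX a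
    (by simp) haX
  rw [Finset.erase_insert (by simp [haX, hab])] at this
  rcases this with h1 | ⟨j, hj, hj', -⟩
  · linarith
  · exact absurd (by simp [hj]) hj'

lemma mn_three {n : ℕ} {F : Finset ℕ → ℝ} (h : MNatConcaveOn n F) (X : Finset ℕ)
    (hX : X ⊆ range n) {a b c : ℕ} (ha : a ∈ range n) (hb : b ∈ range n) (hc : c ∈ range n)
    (haX : a ∉ X) (hcX : c ∉ X) (hab : a ≠ b) (hac : a ≠ c) :
    F (insert a (insert b X)) + F (insert c X) ≤ F (insert a (insert c X)) + F (insert b X) ∨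
    F (insert a (insert b X)) + F (insert c X) ≤ F (insert a X) + F (insert b (insert c X)) := by
  have := h (insert a (insert b X)) (by simp only [insert_subset_iff]; exact ⟨ha, hb, hX⟩)
    (insert c X) (by simp only [insert_subset_iff]; exact ⟨hc, hX⟩) a
    (by simp) (by simp [haX, hac])
  rw [Finset.erase_insert (by simp [haX, hab])] at this
  rcases this with h1 | ⟨j, hj, hj', h1⟩
  · left; linarith
  · have : j = c := by
      simp only [mem_insert] at hj hj'; tauto
    subst this
    right
    rw [Finset.insert_comm a j, Finset.erase_insert (by simp [hcX, hac.symm]),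
      Finset.insert_comm j b] at h1
    linarith

lemma mn_local4 {n : ℕ} {F : Finset ℕ → ℝ} (h : MNatConcaveOn n F) (X : Finset ℕ)
    (hX : X ⊆ range n) {a b c d : ℕ} (ha : a ∈ range n) (hb : b ∈ range n) (hc : c ∈ range n)
    (hd : d ∈ range n)
    (haX : a ∉ X) (hbX : b ∉ X) (hcX : c ∉ X) (hdX : d ∉ X) (hab : a ≠ b) (hac : a ≠ c)
    (had : a ≠ d) (hbc : b ≠ c) (hbd : b ≠ d) (hcd : c ≠ d) :
    F (insert a (insert b X)) + F (insert c (insert d X)) ≤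
      F (insert a (insert c X)) + F (insert b (insert d X)) ∨
    F (insert a (insert b X)) + F (insert c (insert d X)) ≤
      F (insert a (insert d X)) + F (insert b (insert c X)) := by
  by_contra! hcon
  obtain ⟨k1, k2⟩ := hcon
  have iab := Finset.insert_comm b a X
  have iac := Finset.insert_comm c a X
  have iad := Finset.insert_comm d a X
  have ibc := Finset.insert_comm c b X
  have ibd := Finset.insert_comm d b X
  have icd := Finset.insert_comm d c X
  -- triangles
  have r1 := mn_three h X hX ha hb hc haX hcX hab hac
  have r2 := mn_three h X hX ha hb hd haX hdX hab had
  have r3 := mn_three h X hX hc hd ha hcX haX hcd hac.symm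
  have r4 := mn_three h X hX hc hd hb hcX hbX hcd hbc.symm
  simp only [iab, iac, iad, ibc, ibd, icd] at r1 r2 r3 r4
  have u := aux_ultra (F (insert a (insert b X)) - F (insert a X) - F (insert b X))
    (F (insert a (insert c X)) - F (insert a X) - F (insert c X))
    (F (insert a (insert d X)) - F (insert a X) - F (insert d X))
    (F (insert b (insert c X)) - F (insert b X) - F (insert c X))
    (F (insert b (insert d X)) - F (insert b X) - F (insert d X))
    (F (insert c (insert d X)) - F (insert c X) - F (insert d X))
    (r1.imp (fun _ => by linarith) (fun _ => by linarith))
    (r2.imp (fun _ => by linarith) (fun _ => by linarith))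
    (r3.imp (fun _ => by linarith) (fun _ => by linarith))
    (r4.imp (fun _ => by linarith) (fun _ => by linarith))
  rcases u with u | u <;> linarith

lemma local_lift {n : ℕ} {F : Finset ℕ → ℝ} (h : MNatConcaveOn n F) :
    LocalEx (fun T => F (T ∩ Finset.range n)) := by
  intro C a b c d haC hbC hcC hdC hab hac had hbc hbd hcd
  have hX : C ∩ range n ⊆ range n := Finset.inter_subset_right
  have haX : a ∉ C ∩ range n := by simp [haC]
  have hbX : b ∉ C ∩ range n := by simp [hbC]
  have hcX : c ∉ C ∩ range n := by simp [hcC]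
  have hdX : d ∉ C ∩ range n := by simp [hdC]
  by_cases ha : a ∈ range n <;> by_cases hb : b ∈ range n <;>
  by_cases hc : c ∈ range n <;> by_cases hd : d ∈ range n <;>
  simp only [Finset.insert_inter_of_mem, Finset.insert_inter_of_notMem, ha, hb, hc, hd,
    not_false_eq_true] <;>
  generalize C ∩ range n = X at *
  all_goals try (first | (left; linarith) | (right; linarith))
  · exact mn_local4 h X hX ha hb hc hd haX hbX hcX hdX hab hac had hbc hbd hcd
  · rcases mn_three h X hX ha hb hc haX hcX hab hac with h1 | h1
    · left; linarith
    · right; linarith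
  · rcases mn_three h X hX ha hb hd haX hdX hab had with h1 | h1
    · right; linarith
    · left; linarith
  · left; linarith [mn_two h X hX ha hb haX hab]
  · have := mn_three h X hX hc hd ha hcX haX hcd hac.symm
    rw [Finset.insert_comm c a, Finset.insert_comm d a] at this
    rcases this with h1 | h1
    · left; linarith
    · right; linarith
  · have := mn_three h X hX hc hd hb hcX hbX hcd hbc.symm
    rw [Finset.insert_comm c b, Finset.insert_comm d b] at this
    rcases this with h1 | h1
    · right; linarith
    · left; linarith
  · left; linarith [mn_two h X hX hc hd hcX hcd]

theorem mnatconcave_iff_multisymmetric_lift_in_dressian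
    (n : ℕ) (hn : 1 ≤ n) (F : Finset ℕ → ℝ) :
    MNatConcaveOn n F ↔
      InDressian n (2 * n) (fun T => F (T ∩ Finset.range n)) := by
  constructor
  · intro h S _ hSc T _ hTc
    have hp := local_lift h
    generalize (fun T => F (T ∩ Finset.range n)) = p at *
    have hcard : 2 ≤ (T \ S).card := by
      have := Finset.le_card_sdiff S T
      omega
    obtain ⟨i, hi, hmax⟩ := Finset.exists_max_image (T \ S)
      (fun i => p (insert i S) + p (T.erase i)) (Finset.card_pos.1 (by omega))
    obtain ⟨hiT, hiS⟩ := Finset.mem_sdiff.1 hi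
    have hc : (insert i S).card = (T.erase i).card := by
      rw [Finset.card_insert_of_notMem hiS, Finset.card_erase_of_mem hiT]; omega
    have hpos : 0 < (insert i S \ T.erase i).card :=
      Finset.card_pos.2 ⟨i, by simp⟩
    obtain ⟨j, hj, hj', hle⟩ := exch_of_local p hp ((insert i S \ T.erase i).card - 1)
      (insert i S) (T.erase i) hc (by omega) i (by simp) (by simp)
    rw [Finset.erase_insert hiS] at hle
    simp only [mem_erase] at hj
    simp only [mem_insert, not_or] at hj'
    have e : insert i ((T.erase i).erase j) = T.erase j := by
      ext t; simp only [mem_insert, mem_erase]; grind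
    rw [e] at hle
    have hjm : j ∈ T \ S := by simp [hj.2, hj'.2]
    exact ⟨i, hi, j, hjm, fun e => hj.1 e.symm, le_antisymm hle (hmax j hjm), hmax⟩
  · intro h S hS T hT i hi hi'
    have cS : S.card ≤ n := by simpa using Finset.card_le_card hS
    have cT : T.card ≤ n := by simpa using Finset.card_le_card hT
    have hS' : ∀ t ∈ S, t < n := fun t ht => by simpa using hS ht
    have hT' : ∀ t ∈ T, t < n := fun t ht => by simpa using hT ht
    have hin := hS' i hi
    have dis : ∀ U : Finset ℕ, (∀ t ∈ U, t < n) → ∀ m, Disjoint U (Finset.Ico n m) := by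
      intro U hU m
      rw [Finset.disjoint_left]
      intro t ht ht'
      have := hU t ht
      simp at ht'; omega
    obtain ⟨x, hx, y, hy, hxy, hf, hm⟩ := h (S.erase i ∪ Finset.Ico n (n + (n - S.card)))
      (by
        intro t ht
        simp only [mem_union, mem_erase, Finset.mem_Ico, mem_range] at ht ⊢
        rcases ht with ht | ht
        · have := hS' t ht.2; omega
        · omega)
      (by
        rw [Finset.card_union_of_disjoint (dis _ (fun t ht => hS' t (Finset.mem_of_mem_erase ht)) _),
          Finset.card_erase_of_mem hi, Nat.card_Ico]
        have : 0 < S.card := Finset.card_pos.2 ⟨i, hi⟩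
        omega)
      (insert i T ∪ Finset.Ico n (n + (n - T.card)))
      (by
        intro t ht
        simp only [mem_union, mem_insert, Finset.mem_Ico, mem_range] at ht ⊢
        rcases ht with (ht | ht) | ht
        · omega
        · have := hT' t ht; omega
        · omega)
      (by
        rw [Finset.card_union_of_disjoint (dis _ (fun t ht => by
            rcases Finset.mem_insert.1 ht with rfl | ht
            · exact hin
            · exact hT' t ht) _),
          Finset.card_insert_of_notMem hi', Nat.card_Ico]
        omega)
    have hmi := hm i (by
      simp only [mem_sdiff, mem_union, mem_insert, mem_erase, Finset.mem_Ico]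
      refine ⟨by simp, ?_⟩
      rintro (h1 | h1)
      · exact h1.1 rfl
      · omega)
    obtain ⟨j, hj, hji, hle⟩ : ∃ j ∈ (insert i T ∪ Finset.Ico n (n + (n - T.card))) \
        (S.erase i ∪ Finset.Ico n (n + (n - S.card))), j ≠ i ∧
        (fun T => F (T ∩ range n)) (insert i (S.erase i ∪ Ico n (n + (n - #S)))) +
          (fun T => F (T ∩ range n)) ((insert i T ∪ Ico n (n + (n - #T))).erase i) ≤
        (fun T => F (T ∩ range n)) (insert j (S.erase i ∪ Ico n (n + (n - #S)))) +
          (fun T => F (T ∩ range n)) ((insert i T ∪ Ico n (n + (n - #T))).erase j) := by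
      by_cases hxi : x = i
      · exact ⟨y, hy, fun e => hxy (hxi.trans e.symm), hmi.trans hf.le⟩
      · exact ⟨x, hx, hxi, hmi⟩
    simp only at hle
    have e1 : insert i (S.erase i ∪ Finset.Ico n (n + (n - S.card))) ∩ range n = S := by
      ext t
      have := hS' t
      simp only [mem_inter, mem_union, mem_insert, mem_erase, Finset.mem_Ico, mem_range]
      grind
    have e2 : (insert i T ∪ Finset.Ico n (n + (n - T.card))).erase i ∩ range n = T := by
      ext t
      have := hT' t
      simp only [mem_inter, mem_union, mem_insert, mem_erase, Finset.mem_Ico, mem_range]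
      grind
    rw [e1, e2] at hle
    simp only [mem_sdiff, mem_union, mem_insert, mem_erase, Finset.mem_Ico] at hj
    by_cases hjn : j < n
    · right
      refine ⟨j, by grind, by grind, ?_⟩
      have e3 : insert j (S.erase i ∪ Finset.Ico n (n + (n - S.card))) ∩ range n =
          insert j (S.erase i) := by
        ext t
        have := hS' t
        simp only [mem_inter, mem_union, mem_insert, mem_erase, Finset.mem_Ico, mem_range]
        grind
      have e4 : (insert i T ∪ Finset.Ico n (n + (n - T.card))).erase j ∩ range n =
          (insert i T).erase j := by
        ext t
        have := hT' t
        simp only [mem_inter, mem_union, mem_insert, mem_erase, Finset.mem_Ico, mem_range]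
        grind
      rwa [e3, e4] at hle
    · left
      have e3 : insert j (S.erase i ∪ Finset.Ico n (n + (n - S.card))) ∩ range n =
          S.erase i := by
        ext t
        have := hS' t
        simp only [mem_inter, mem_union, mem_insert, mem_erase, Finset.mem_Ico, mem_range]
        grind
      have e4 : (insert i T ∪ Finset.Ico n (n + (n - T.card))).erase j ∩ range n =
          insert i T := by
        ext t
        have := hT' t
        simp only [mem_inter, mem_union, mem_insert, mem_erase, Finset.mem_Ico, mem_range]
        grind
      rwa [e3, e4] at hle
end

section
/- For a function F : 2^{[n]} → ℝ and 1 ≤ k ≤ n-2, define the homogenized layer F̃_k on the (k+1)-element subsets of [n+1] by F̃_k(S) = F(S) if n+1 ∉ S and F̃_k(S) = F(S∖{n+1}) if n+1 ∈ S. Then F is M♮-concave if and only if F is submodular and, for every 1 ≤ k ≤ n-2, the function F̃_k lies in the Dressian Dr(k+1,n+1). -/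
open Finset

/-- Submodularity of a function on subsets of the ground set `{0, ..., n-1}`. -/
def SubmodularOn (n : ℕ) (F : Finset ℕ → ℝ) : Prop :=
  ∀ S ⊆ Finset.range n, ∀ T ⊆ Finset.range n,
    F (S ∩ T) + F (S ∪ T) ≤ F S + F T

def LocOne (n : ℕ) (F : Finset ℕ → ℝ) : Prop :=
  ∀ X ⊆ Finset.range n, ∀ i < n, ∀ j < n, i ∉ X → j ∉ X → i ≠ j →
    F (insert i (insert j X)) + F X ≤ F (insert i X) + F (insert j X)

def LocTwo (n : ℕ) (F : Finset ℕ → ℝ) : Prop :=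
  ∀ X ⊆ Finset.range n, ∀ i < n, ∀ j < n, ∀ k < n, i ∉ X → j ∉ X → k ∉ X →
    i ≠ j → i ≠ k → j ≠ k →
    (F (insert i (insert j X)) + F (insert k X) ≤ F (insert i (insert k X)) + F (insert j X) ∨
     F (insert i (insert j X)) + F (insert k X) ≤ F (insert j (insert k X)) + F (insert i X))

def ThreeTerm (p : Finset ℕ → ℝ) : Prop :=
  ∀ X a b c d, a ∉ X → b ∉ X → c ∉ X → d ∉ X → a ≠ b → a ≠ c → a ≠ d → b ≠ c → b ≠ d → c ≠ d →
    (p (insert a (insert b X)) + p (insert c (insert d X)) ≤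
      p (insert a (insert c X)) + p (insert b (insert d X)) ∨
     p (insert a (insert b X)) + p (insert c (insert d X)) ≤
      p (insert a (insert d X)) + p (insert b (insert c X)))

theorem four_point (f12 f13 f14 f23 f24 f34 f1 f2 f3 f4 : ℝ)
    (h1 : f12 + f3 ≤ f13 + f2 ∨ f12 + f3 ≤ f23 + f1)
    (h2 : f12 + f4 ≤ f14 + f2 ∨ f12 + f4 ≤ f24 + f1)
    (h3 : f34 + f1 ≤ f13 + f4 ∨ f34 + f1 ≤ f14 + f3)
    (h4 : f34 + f2 ≤ f23 + f4 ∨ f34 + f2 ≤ f24 + f3) :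
    f12 + f34 ≤ f13 + f24 ∨ f12 + f34 ≤ f14 + f23 := by
  by_contra hc
  push Not at hc
  obtain ⟨c1, c2⟩ := hc
  rcases h1 with h1 | h1 <;> rcases h2 with h2 | h2 <;> rcases h3 with h3 | h3 <;>
    rcases h4 with h4 | h4 <;> linarith

theorem threeTerm_of_loc (n : ℕ) (F : Finset ℕ → ℝ) (h1 : LocOne n F) (h2 : LocTwo n F) :
    ThreeTerm (fun A => F (A ∩ Finset.range n)) := by
  intro X a b c d ha hb hc hd hab hac had hbc hbd hcd
  have hX : X ∩ Finset.range n ⊆ Finset.range n := Finset.inter_subset_right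
  have ha' : a ∉ X ∩ Finset.range n := fun h => ha (Finset.mem_inter.1 h).1
  have hb' : b ∉ X ∩ Finset.range n := fun h => hb (Finset.mem_inter.1 h).1
  have hc' : c ∉ X ∩ Finset.range n := fun h => hc (Finset.mem_inter.1 h).1
  have hd' : d ∉ X ∩ Finset.range n := fun h => hd (Finset.mem_inter.1 h).1
  have key : ∀ (e : ℕ) (Z : Finset ℕ), (insert e Z) ∩ Finset.range n =
      if e < n then insert e (Z ∩ Finset.range n) else Z ∩ Finset.range n := by
    intro e Z
    split_ifs with h
    · exact Finset.insert_inter_of_mem (Finset.mem_range.2 h)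
    · exact Finset.insert_inter_of_notMem (fun h' => h (Finset.mem_range.1 h'))
  simp only [key]
  generalize X ∩ Finset.range n = Y at *
  have cm : ∀ x y : ℕ, insert x (insert y Y) = insert y (insert x Y) :=
    fun x y => Finset.insert_comm x y Y
  have T1 := h1 Y hX
  have T2 := h2 Y hX
  by_cases a1 : a < n <;> by_cases b1 : b < n <;> by_cases c1 : c < n <;> by_cases d1 : d < n <;>
    simp only [a1, b1, c1, d1, if_true, if_false]
  · exact four_point _ _ _ _ _ _ (F (insert a Y)) (F (insert b Y)) (F (insert c Y)) (F (insert d Y))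
      (T2 a a1 b b1 c c1 ha' hb' hc' hab hac hbc)
      (T2 a a1 b b1 d d1 ha' hb' hd' hab had hbd)
      (by have := T2 c c1 d d1 a a1 hc' hd' ha' hcd hac.symm had.symm
          rwa [cm c a, cm d a] at this)
      (by have := T2 c c1 d d1 b b1 hc' hd' hb' hcd hbc.symm hbd.symm
          rwa [cm c b, cm d b] at this)
  all_goals grind [LocOne, LocTwo]

theorem set_aux1 (B : Finset ℕ) (u w v z : ℕ) (huB : u ∉ B) (hwB : w ∉ B) (huv : u ≠ v)
    (huz : u ≠ z) (hwv : w ≠ v) (hwz : w ≠ z) :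
    insert u (insert w ((B.erase v).erase z)) = (insert u ((insert w B).erase v)).erase z := by
  ext x; simp only [mem_erase, mem_insert]; grind

theorem set_aux2 (B : Finset ℕ) (v z : ℕ) (hv : v ∈ B) (hz : z ∈ B) :
    insert v (insert z ((B.erase v).erase z)) = B := by
  ext x; simp only [mem_erase, mem_insert]; grind

theorem set_aux3 (B : Finset ℕ) (u v z : ℕ) (huB : u ∉ B) (huz : u ≠ z) (hv : v ∈ B)
    (hvz : v ≠ z) :
    insert u (insert v ((B.erase v).erase z)) = (insert u B).erase z := by
  ext x; simp only [mem_erase, mem_insert]; grind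

theorem exchange (p : Finset ℕ → ℝ) (hp : ThreeTerm p) :
    ∀ (m : ℕ) (A B : Finset ℕ), (B \ A).card = m → A.card = B.card → ∀ u ∈ A, u ∉ B →
      ∃ v ∈ B, v ∉ A ∧ p A + p B ≤ p (insert v (A.erase u)) + p ((insert u B).erase v) := by
  intro m
  induction m with
  | zero =>
    intro A B h0 hc u hu huB
    exfalso
    have h1 : (A \ B).card = (B \ A).card := by
      have := Finset.card_sdiff_add_card_inter A B
      have h2 := Finset.card_sdiff_add_card_inter B A
      rw [Finset.inter_comm] at h2
      omega
    have : 0 < (A \ B).card := Finset.card_pos.2 ⟨u, by simp [hu, huB]⟩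
    omega
  | succ m ih =>
    intro A B hm hc u hu huB
    have h1 : (A \ B).card = (B \ A).card := by
      have := Finset.card_sdiff_add_card_inter A B
      have h2 := Finset.card_sdiff_add_card_inter B A
      rw [Finset.inter_comm] at h2
      omega
    by_cases hex : ∃ w ∈ A \ B, w ≠ u
    · obtain ⟨w, hw, hwu⟩ := hex
      obtain ⟨hwA, hwB⟩ := Finset.mem_sdiff.1 hw
      by_contra hcon
      push Not at hcon
      have hne : (B \ A).Nonempty := Finset.card_pos.1 (by omega)
      -- weight-corrected maximizer
      obtain ⟨v, hv, hmax⟩ := Finset.exists_max_image (B \ A)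
        (fun v => p ((insert w B).erase v) + p (insert v (A.erase u))) hne
      obtain ⟨hvB, hvA⟩ := Finset.mem_sdiff.1 hv
      have huv : u ≠ v := fun h => hvA (h ▸ hu)
      have hwv : w ≠ v := fun h => hvA (h ▸ hwA)
      have hB'A : ((insert w B).erase v) \ A = (B \ A).erase v := by
        ext x; simp only [mem_sdiff, mem_erase, mem_insert]; grind
      have hcard : (((insert w B).erase v) \ A).card = m := by
        rw [hB'A, Finset.card_erase_of_mem hv]; omega
      have hcard2 : A.card = ((insert w B).erase v).card := by
        rw [Finset.card_erase_of_mem (by simp [hvB]), Finset.card_insert_of_notMem hwB]; omega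
      obtain ⟨z, hz, hzA, hle⟩ := ih A ((insert w B).erase v) hcard hcard2 u hu
        (by simp only [mem_erase, mem_insert]; tauto)
      have hzv : z ≠ v := (Finset.mem_erase.1 hz).1
      have hzB : z ∈ B := by
        have := (Finset.mem_erase.1 hz).2
        rcases Finset.mem_insert.1 this with h | h
        · exact absurd hwA (h ▸ hzA)
        · exact h
      have huz : u ≠ z := fun h => hzA (h ▸ hu)
      have hwz : w ≠ z := fun h => hzA (h ▸ hwA)
      have c1 := hcon z hzB hzA
      have c2 := hcon v hvB hvA
      have c3 := hmax z (by simp [hzB, hzA])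
      have t := hp ((B.erase v).erase z) u w v z (by simp [huB]) (by simp [hwB]) (by simp)
        (by simp) hwu.symm huv huz hwv hwz hzv.symm
      have e1 := set_aux1 B u w v z huB hwB huv huz hwv hwz
      have e2 := set_aux2 B v z hvB hzB
      have e3 := set_aux3 B u v z huB huz hvB hzv.symm
      have e4 := set_aux3 B w z v hwB hwv hzB hzv
      have e5 := set_aux3 B u z v huB huv hzB hzv
      have e6 := set_aux3 B w v z hwB hwz hvB hzv.symm
      rw [Finset.erase_right_comm] at e4 e5
      rw [e1, e2, e3, e4, e5, e6] at t
      rcases t with t | t <;> linarith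
    · push Not at hex
      have hAB : A \ B = {u} := by
        ext x; simp only [mem_singleton]
        exact ⟨fun h => hex x h, fun h => by subst h; simp [hu, huB]⟩
      have : (B \ A).card = 1 := by rw [← h1, hAB]; simp
      obtain ⟨v, hv⟩ := Finset.card_eq_one.1 this
      have hvm : v ∈ B \ A := by rw [hv]; simp
      obtain ⟨hvB, hvA⟩ := Finset.mem_sdiff.1 hvm
      have f1 : ∀ x, x ∈ A → x ∉ B → x = u := fun x h h' => hex x (by simp [h, h'])
      have f2 : ∀ x, x ∈ B → x ∉ A → x = v := fun x h h' => by
        have : x ∈ B \ A := by simp [h, h']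
        rw [hv] at this; simpa using this
      refine ⟨v, hvB, hvA, ?_⟩
      have e1 : insert v (A.erase u) = B := by
        ext x; simp only [mem_erase, mem_insert]; grind
      have e2 : (insert u B).erase v = A := by
        ext x; simp only [mem_erase, mem_insert]; grind
      rw [e1, e2]; linarith

theorem mnat_of_exchange (n : ℕ) (F : Finset ℕ → ℝ)
    (h : ThreeTerm (fun A => F (A ∩ Finset.range n))) : MNatConcaveOn n F := by
  intro S hS T hT i hi hiT
  have hS' : ∀ x ∈ S, x < n := fun x hx => Finset.mem_range.1 (hS hx)
  have hT' : ∀ x ∈ T, x < n := fun x hx => Finset.mem_range.1 (hT hx)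
  have hin := hS' i hi
  have dS : Disjoint S (Finset.Ico n (n + T.card)) := by
    rw [Finset.disjoint_left]; intro x hx hx'
    have := hS' x hx; simp at hx'; omega
  have dT : Disjoint T (Finset.Ico n (n + S.card)) := by
    rw [Finset.disjoint_left]; intro x hx hx'
    have := hT' x hx; simp at hx'; omega
  obtain ⟨v, hv, hvA, hle⟩ := exchange _ h _ (S ∪ Finset.Ico n (n + T.card))
    (T ∪ Finset.Ico n (n + S.card)) rfl
    (by rw [Finset.card_union_of_disjoint dS, Finset.card_union_of_disjoint dT]; simp; omega)
    i (by simp [hi]) (by simp [hiT]; omega)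
  simp only [mem_union, mem_Ico, not_or] at hv hvA
  have e1 : (S ∪ Finset.Ico n (n + T.card)) ∩ Finset.range n = S := by
    ext x; have := hS' x; simp only [mem_inter, mem_union, mem_Ico, mem_range]; grind
  have e2 : (T ∪ Finset.Ico n (n + S.card)) ∩ Finset.range n = T := by
    ext x; have := hT' x; simp only [mem_inter, mem_union, mem_Ico, mem_range]; grind
  simp only [e1, e2] at hle
  by_cases hvn : v < n
  · right
    refine ⟨v, by rcases hv with hv | hv; exact hv; omega, hvA.1, ?_⟩
    have e3 : (insert v ((S ∪ Finset.Ico n (n + T.card)).erase i)) ∩ Finset.range n =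
        insert v (S.erase i) := by
      ext x; have := hS' x
      simp only [mem_inter, mem_union, mem_Ico, mem_range, mem_erase, mem_insert]; grind
    have e4 : ((insert i (T ∪ Finset.Ico n (n + S.card))).erase v) ∩ Finset.range n =
        (insert i T).erase v := by
      ext x; have := hT' x
      simp only [mem_inter, mem_union, mem_Ico, mem_range, mem_erase, mem_insert]; grind
    rwa [e3, e4] at hle
  · left
    have e3 : (insert v ((S ∪ Finset.Ico n (n + T.card)).erase i)) ∩ Finset.range n =
        S.erase i := by
      ext x; have := hS' x
      simp only [mem_inter, mem_union, mem_Ico, mem_range, mem_erase, mem_insert]; grind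
    have e4 : ((insert i (T ∪ Finset.Ico n (n + S.card))).erase v) ∩ Finset.range n =
        insert i T := by
      ext x; have := hT' x
      simp only [mem_inter, mem_union, mem_Ico, mem_range, mem_erase, mem_insert]; grind
    rwa [e3, e4] at hle

theorem dress_of_exchange (n : ℕ) (F : Finset ℕ → ℝ)
    (h : ThreeTerm (fun A => F (A ∩ Finset.range n))) (k : ℕ) :
    InDressian (k + 1) (n + 1) (fun S => F (S.erase n)) := by
  intro S hS hSc T hT hTc
  have conv : ∀ A ⊆ Finset.range (n + 1), A.erase n = A ∩ Finset.range n := by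
    intro A hA; ext x
    have : x ∈ A → x < n + 1 := fun hx => Finset.mem_range.1 (hA hx)
    simp only [mem_erase, mem_inter, mem_range]; grind
  have hne : (T \ S).Nonempty := by
    rw [Finset.sdiff_nonempty]; intro hsub
    have := Finset.card_le_card hsub; omega
  obtain ⟨i, hi, hmax⟩ := Finset.exists_max_image (T \ S)
    (fun i => F ((insert i S).erase n) + F ((T.erase i).erase n)) hne
  obtain ⟨hiT, hiS⟩ := Finset.mem_sdiff.1 hi
  obtain ⟨j, hj, hjA, hle⟩ := exchange _ h _ (insert i S) (T.erase i) rfl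
    (by rw [Finset.card_insert_of_notMem hiS, Finset.card_erase_of_mem hiT]; omega)
    i (by simp) (by simp)
  have hji : j ≠ i := (Finset.mem_erase.1 hj).1
  have hjT : j ∈ T := (Finset.mem_erase.1 hj).2
  have hjS : j ∉ S := fun h => hjA (by simp [h])
  have e1 : insert j ((insert i S).erase i) = insert j S := by
    rw [Finset.erase_insert hiS]
  have e2 : (insert i (T.erase i)).erase j = T.erase j := by
    rw [Finset.insert_erase hiT]
  have sub1 : ∀ x ∈ T, insert x S ⊆ Finset.range (n + 1) := fun x hx =>
    Finset.insert_subset (hT hx) hS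
  have sub2 : ∀ x, T.erase x ⊆ Finset.range (n + 1) := fun x =>
    (Finset.erase_subset _ _).trans hT
  simp only [e1, e2] at hle
  rw [← conv _ (sub1 i hiT), ← conv _ (sub1 j hjT), ← conv _ (sub2 i), ← conv _ (sub2 j)] at hle
  have hj' : j ∈ T \ S := by simp [hjT, hjS]
  exact ⟨i, hi, j, hj', hji.symm, le_antisymm hle (hmax j hj'), hmax⟩

theorem loc_of_mnat (n : ℕ) (F : Finset ℕ → ℝ) (h : MNatConcaveOn n F) :
    LocOne n F ∧ LocTwo n F := by
  constructor
  · intro X hX i hi j hj hiX hjX hij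
    have hi' := Finset.mem_range.2 hi
    have hj' := Finset.mem_range.2 hj
    rcases h (insert i (insert j X)) (insert_subset hi' (insert_subset hj' hX)) X hX i (by simp) hiX
      with h | ⟨l, hl, hl', -⟩
    · rw [Finset.erase_insert (by simp [hij, hiX])] at h; linarith
    · exact absurd hl (by grind)
  · intro X hX i hi j hj k hk hiX hjX hkX hij hik hjk
    have hi' := Finset.mem_range.2 hi
    have hj' := Finset.mem_range.2 hj
    have hk' := Finset.mem_range.2 hk
    rcases h (insert i (insert j X)) (insert_subset hi' (insert_subset hj' hX)) (insert k X)
      (insert_subset hk' hX) i (by simp) (by simp [hik, hiX]) with h | ⟨l, hl, hl', h⟩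
    · rw [Finset.erase_insert (by simp [hij, hiX])] at h; left; linarith
    · have : l = k := by grind
      subst this
      rw [Finset.erase_insert (by simp [hij, hiX]), Finset.insert_comm i l,
        Finset.erase_insert (by simp [hik.symm, hkX]), Finset.insert_comm l j] at h
      right; linarith

theorem sub_of_loc (n : ℕ) (F : Finset ℕ → ℝ) (h : LocOne n F) : SubmodularOn n F := by
  have step : ∀ (X : Finset ℕ), X ⊆ range n → ∀ e < n, ∀ Z : Finset ℕ, Z ⊆ range n → e ∉ X →
      e ∉ Z → Disjoint Z X → F (insert e (Z ∪ X)) + F X ≤ F (insert e X) + F (Z ∪ X) := by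
    intro X hX e he Z
    induction Z using Finset.induction_on with
    | empty => intros; simp
    | insert a Z haZ ih =>
      intro hZ heX heZ hd
      rw [Finset.insert_subset_iff] at hZ
      rw [Finset.disjoint_insert_left] at hd
      have i1 := ih hZ.2 heX (fun h => heZ (by simp [h])) hd.2
      have i2 := h (Z ∪ X) (union_subset hZ.2 hX) e he a (mem_range.1 hZ.1)
        (by grind) (by grind) (by grind)
      rw [Finset.insert_union]
      linarith
  have step2 : ∀ (X Y : Finset ℕ), X ⊆ Y → Y ⊆ range n → ∀ Z : Finset ℕ, Z ⊆ range n →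
      Disjoint Z Y → F (Z ∪ Y) + F X ≤ F (Z ∪ X) + F Y := by
    intro X Y hXY hY Z
    induction Z using Finset.induction_on with
    | empty => intros; simp [add_comm]
    | insert a Z haZ ih =>
      intro hZ hd
      rw [Finset.insert_subset_iff] at hZ
      rw [Finset.disjoint_insert_left] at hd
      have i1 := ih hZ.2 hd.2
      have i2 := step (Z ∪ X) (union_subset hZ.2 (hXY.trans hY)) a (mem_range.1 hZ.1) (Y \ X)
        (sdiff_subset.trans hY) (by grind) (by grind) (by
          rw [Finset.disjoint_left] at *
          have := hd.2
          grind)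
      have e : Y \ X ∪ (Z ∪ X) = Z ∪ Y := by grind
      rw [e] at i2
      rw [Finset.insert_union, Finset.insert_union]
      linarith
  intro S hS T hT
  have := step2 (S ∩ T) T inter_subset_right hT (S \ T) (sdiff_subset.trans hS) sdiff_disjoint
  rw [Finset.sdiff_union_self_eq_union, Finset.sdiff_union_inter] at this
  linarith

theorem loc_of_sub_dress (n : ℕ) (F : Finset ℕ → ℝ) (hs : SubmodularOn n F)
    (hd : ∀ k : ℕ, 1 ≤ k → k + 2 ≤ n →
          InDressian (k + 1) (n + 1) (fun S => F (S.erase n))) : LocOne n F ∧ LocTwo n F := by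
  constructor
  · intro X hX i hi j hj hiX hjX hij
    have hi' := Finset.mem_range.2 hi
    have hj' := Finset.mem_range.2 hj
    have := hs (insert i X) (insert_subset hi' hX) (insert j X) (insert_subset hj' hX)
    have e1 : insert i X ∩ insert j X = X := by ext; simp only [mem_inter, mem_insert]; grind
    have e2 : insert i X ∪ insert j X = insert i (insert j X) := by
      ext; simp only [mem_union, mem_insert]; grind
    rw [e1, e2] at this
    linarith
  · intro X hX i hi j hj k hk hiX hjX hkX hij hik hjk
    have hi' := Finset.mem_range.2 hi
    have hj' := Finset.mem_range.2 hj
    have hk' := Finset.mem_range.2 hk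
    have hnX : n ∉ X := fun h => by simpa using hX h
    have cX : X.card + 3 ≤ n := by
      have : insert i (insert j (insert k X)) ⊆ range n :=
        insert_subset hi' (insert_subset hj' (insert_subset hk' hX))
      have := card_le_card this
      rw [card_insert_of_notMem (by simp [hij, hik, hiX]),
        card_insert_of_notMem (by simp [hjk, hjX]), card_insert_of_notMem hkX, card_range] at this
      omega
    have hXn : X ⊆ range (n + 1) := hX.trans (range_subset_range.2 (by omega))
    have D := hd (X.card + 1) (by omega) (by omega) (insert k X)
      (insert_subset (by simp; omega) hXn) (by rw [card_insert_of_notMem hkX]; omega)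
      (insert i (insert j (insert n X)))
      (insert_subset (by simp; omega) (insert_subset (by simp; omega)
        (insert_subset (by simp) hXn)))
      (by rw [card_insert_of_notMem (by simp [hij, hi.ne, hiX]),
        card_insert_of_notMem (by simp [hj.ne, hjX]), card_insert_of_notMem hnX])
    have eD : insert i (insert j (insert n X)) \ insert k X = {i, j, n} := by
      ext x; simp only [mem_sdiff, mem_insert, mem_singleton]; grind
    rw [eD] at D
    set f : ℕ → ℝ := fun x => F ((insert x (insert k X)).erase n) +
      F (((insert i (insert j (insert n X))).erase x).erase n) with hf
    have fi : f i = F (insert i (insert k X)) + F (insert j X) := by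
      simp only [hf]; congr 2 <;> ext x <;> simp only [mem_erase, mem_insert] <;> grind
    have fj : f j = F (insert j (insert k X)) + F (insert i X) := by
      simp only [hf]; congr 2 <;> ext x <;> simp only [mem_erase, mem_insert] <;> grind
    have fn : f n = F (insert k X) + F (insert i (insert j X)) := by
      simp only [hf]; congr 2 <;> ext x <;> simp only [mem_erase, mem_insert] <;> grind
    obtain ⟨a, ha, b, hb, hab, hfab, hm⟩ := D
    change f a = f b at hfab
    have hmn : f n ≤ f a := hm n (by simp)
    have hmn' : f n ≤ f b := hfab ▸ hmn
    have : f n ≤ f i ∨ f n ≤ f j := by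
      simp only [mem_insert, mem_singleton] at ha hb
      rcases ha with rfl | rfl | rfl
      · exact Or.inl hmn
      · exact Or.inr hmn
      · rcases hb with rfl | rfl | rfl
        · exact Or.inl hmn'
        · exact Or.inr hmn'
        · exact absurd rfl hab
    rw [fi, fj, fn] at this
    rcases this with h | h
    · left; linarith
    · right; linarith

/- The homogenized layer `F̃ₖ` is a function on (k+1)-element subsets of the ground
set `{0, ..., n}` (where the new element `n` plays the role of `n+1`); it is given by
`S ↦ F (S.erase n)`, which equals `F S` when `n ∉ S`. -/
theorem mnatconcave_iff_submodular_and_layers_in_dressians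
    (n : ℕ) (F : Finset ℕ → ℝ) :
    MNatConcaveOn n F ↔
      (SubmodularOn n F ∧
        ∀ k : ℕ, 1 ≤ k → k + 2 ≤ n →
          InDressian (k + 1) (n + 1) (fun S => F (S.erase n))) := by
  constructor
  · intro h
    obtain ⟨h1, h2⟩ := loc_of_mnat n F h
    exact ⟨sub_of_loc n F h1, fun k _ _ => dress_of_exchange n F (threeTerm_of_loc n F h1 h2) k⟩
  · rintro ⟨hs, hd⟩
    obtain ⟨h1, h2⟩ := loc_of_sub_dress n F hs hd
    exact mnat_of_exchange n F (threeTerm_of_loc n F h1 h2)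
end

section
/- A function F : 2^{[n]} → ℝ is M♮-concave if and only if F is submodular and F lies in the affine flag Dressian FlDr(n). -/
open Finset

/-- `p` lies in the affine flag Dressian `FlDr(n)` on the ground set `{0, ..., n-1}`. -/
def InFlagDressian (n : ℕ) (p : Finset ℕ → ℝ) : Prop :=
  ∀ S ⊆ Finset.range n, ∀ T ⊆ Finset.range n, S.card + 2 ≤ T.card →
    MaxAttainedTwice (T \ S) (fun i => p (insert i S) + p (T.erase i))

def P3 (G : Finset ℕ → ℝ) : Prop :=
  ∀ (X : Finset ℕ) (a b c d : ℕ), a ∉ X → b ∉ X → c ∉ X → d ∉ X →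
    a ≠ b → a ≠ c → a ≠ d → b ≠ c → b ≠ d → c ≠ d →
    G (insert a (insert b X)) + G (insert c (insert d X)) ≤
        G (insert a (insert c X)) + G (insert b (insert d X)) ∨
    G (insert a (insert b X)) + G (insert c (insert d X)) ≤
        G (insert a (insert d X)) + G (insert b (insert c X))

set_option maxHeartbeats 4000000 in
theorem global_exch (G : Finset ℕ → ℝ) (h : P3 G) :
    ∀ k : ℕ, ∀ A B : Finset ℕ, (B \ A).card = k → (A \ B).card = k → ∀ u ∈ A, u ∉ B →
      ∃ v ∈ B, v ∉ A ∧ G A + G B ≤ G (insert v (A.erase u)) + G (insert u (B.erase v)) := by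
  intro k
  induction k with
  | zero =>
    intro A B _ h2 u hu hu'
    have : u ∈ A \ B := by simp [hu, hu']
    rw [Finset.card_eq_zero] at h2
    simp [h2] at this
  | succ k ih =>
    intro A B h1 h2 u hu hu'
    by_contra! hcon
    rcases Nat.eq_zero_or_pos k with hk | hk
    · subst hk
      obtain ⟨v, hv⟩ := Finset.card_eq_one.mp h1
      obtain ⟨w, hw⟩ := Finset.card_eq_one.mp h2
      have hvm : v ∈ B ∧ v ∉ A := by
        have : v ∈ B \ A := by simp [hv]
        simpa using this
      have e1 : insert v (A.erase u) = B := by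
        ext x
        have a1 := Finset.ext_iff.mp hv x
        have a2 := Finset.ext_iff.mp hw x
        have a3 := Finset.ext_iff.mp hw u
        grind
      have e2 : insert u (B.erase v) = A := by
        ext x
        have a1 := Finset.ext_iff.mp hv x
        have a2 := Finset.ext_iff.mp hw x
        have a3 := Finset.ext_iff.mp hw u
        grind
      have := hcon v hvm.1 hvm.2
      rw [e1, e2] at this
      linarith
    · have : ∃ u0 ∈ A \ B, u0 ≠ u := by
        apply Finset.exists_mem_ne
        omega
      obtain ⟨u0, hu0, hne⟩ := this
      have hu0' := Finset.mem_sdiff.mp hu0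
      have hnon : (B \ A).Nonempty := by
        rw [← Finset.card_pos]; omega
      obtain ⟨v0, hv0, hmax⟩ := Finset.exists_max_image (B \ A)
        (fun v => G (insert u0 (B.erase v)) + G (insert v (A.erase u))) hnon
      have hv0' := Finset.mem_sdiff.mp hv0
      have c1 : (insert u0 (B.erase v0) \ A).card = k := by
        have : insert u0 (B.erase v0) \ A = (B \ A).erase v0 := by
          ext x; grind
        rw [this, Finset.card_erase_of_mem hv0]; omega
      have c2 : (A \ insert u0 (B.erase v0)).card = k := by
        have : A \ insert u0 (B.erase v0) = (A \ B).erase u0 := by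
          ext x; grind
        rw [this, Finset.card_erase_of_mem hu0]; omega
      obtain ⟨v, hv, hvA, hle⟩ := ih A (insert u0 (B.erase v0)) c1 c2 u hu (by grind)
      have hvB : v ∈ B := by grind
      have hvv0 : v ≠ v0 := by grind
      have m1 := hmax v (by simp [hvB, hvA])
      have s1 := hcon v hvB hvA
      have s2 := hcon v0 hv0'.1 hv0'.2
      have t := h ((B.erase v0).erase v) u u0 v v0 (by grind) (by grind) (by grind) (by grind)
        (by grind) (by grind) (by grind) (by grind) (by grind) (by grind)
      have e1 : insert u (insert u0 ((B.erase v0).erase v)) =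
        insert u ((insert u0 (B.erase v0)).erase v) := by clear t s1 s2 m1 hle hcon hmax ih; ext x; grind
      have e2 : insert v (insert v0 ((B.erase v0).erase v)) = B := by clear t s1 s2 m1 hle hcon hmax ih; ext x; grind
      have e3 : insert u (insert v ((B.erase v0).erase v)) = insert u (B.erase v0) := by
        clear t s1 s2 m1 hle hcon hmax ih; ext x; grind
      have e4 : insert u0 (insert v0 ((B.erase v0).erase v)) = insert u0 (B.erase v) := by
        clear t s1 s2 m1 hle hcon hmax ih; ext x; grind
      have e5 : insert u (insert v0 ((B.erase v0).erase v)) = insert u (B.erase v) := by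
        clear t s1 s2 m1 hle hcon hmax ih; ext x; grind
      have e6 : insert u0 (insert v ((B.erase v0).erase v)) = insert u0 (B.erase v0) := by
        clear t s1 s2 m1 hle hcon hmax ih; ext x; grind
      rw [e1, e2, e3, e4, e5, e6] at t
      rcases t with t | t <;> linarith

def Q1 (n : ℕ) (F : Finset ℕ → ℝ) : Prop :=
  ∀ Y ⊆ Finset.range n, ∀ a b c : ℕ, a < n → b < n → c < n → a ∉ Y → b ∉ Y → c ∉ Y →
    a ≠ b → a ≠ c → b ≠ c →
    F (insert a (insert b Y)) + F (insert c Y) ≤ F (insert a (insert c Y)) + F (insert b Y) ∨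
    F (insert a (insert b Y)) + F (insert c Y) ≤ F (insert b (insert c Y)) + F (insert a Y)

def Q2 (n : ℕ) (F : Finset ℕ → ℝ) : Prop :=
  ∀ Y ⊆ Finset.range n, ∀ a b : ℕ, a < n → b < n → a ∉ Y → b ∉ Y → a ≠ b →
    F (insert a (insert b Y)) + F Y ≤ F (insert a Y) + F (insert b Y)

theorem p3_of (n : ℕ) (F : Finset ℕ → ℝ) (h1 : Q1 n F) (h2 : Q2 n F) :
    P3 (fun B => F (B ∩ Finset.range n)) := by
  intro X a b c d ha hb hc hd hab hac had hbc hbd hcd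
  have hY : X ∩ range n ⊆ range n := Finset.inter_subset_right
  have ha' : a ∉ X ∩ range n := by simp [ha]
  have hb' : b ∉ X ∩ range n := by simp [hb]
  have hc' : c ∉ X ∩ range n := by simp [hc]
  have hd' : d ∉ X ∩ range n := by simp [hd]
  have key : ∀ x (Z : Finset ℕ), insert x Z ∩ range n =
      if x < n then insert x (Z ∩ range n) else Z ∩ range n := by
    intro x Z; split_ifs with hx
    · ext y; grind
    · ext y; grind
  simp only [key]
  generalize X ∩ range n = Y at *
  have k1 := h1 Y hY
  have k2 := h2 Y hY
  have cm : ∀ x y, insert x (insert y Y) = insert y (insert x Y) :=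
    fun x y => Finset.insert_comm x y Y
  by_cases xa : a < n <;> by_cases xb : b < n <;> by_cases xc : c < n <;> by_cases xd : d < n <;>
    simp only [xa, xb, xc, xd, if_true, if_false]
  · have r1 := k1 a b c xa xb xc ha' hb' hc' hab hac hbc
    have r2 := k1 a b d xa xb xd ha' hb' hd' hab had hbd
    have r3 := k1 c d a xc xd xa hc' hd' ha' hcd hac.symm had.symm
    have r4 := k1 c d b xc xd xb hc' hd' hb' hcd hbc.symm hbd.symm
    rw [cm c a, cm d a] at r3
    rw [cm c b, cm d b] at r4
    by_contra! hh
    obtain ⟨g1, g2⟩ := hh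
    rcases r1 with r1 | r1 <;> rcases r2 with r2 | r2 <;> rcases r3 with r3 | r3 <;>
      rcases r4 with r4 | r4 <;> linarith
  · have r := k1 a b c xa xb xc ha' hb' hc' hab hac hbc
    rcases r with r | r
    · left; linarith
    · right; linarith
  · have r := k1 a b d xa xb xd ha' hb' hd' hab had hbd
    rcases r with r | r
    · right; linarith
    · left; linarith
  · have r := k2 a b xa xb ha' hb' hab
    left; linarith
  · have r := k1 c d a xc xd xa hc' hd' ha' hcd hac.symm had.symm
    rw [cm c a, cm d a] at r
    rcases r with r | r
    · left; linarith
    · right; linarith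
  · right; linarith
  · left; linarith
  · left; linarith
  · have r := k1 c d b xc xd xb hc' hd' hb' hcd hbc.symm hbd.symm
    rw [cm c b, cm d b] at r
    rcases r with r | r
    · right; linarith
    · left; linarith
  · left; linarith
  · right; linarith
  · right; linarith
  · have r := k2 c d xc xd hc' hd' hcd
    left; linarith
  · left; linarith
  · left; linarith
  · left; linarith

set_option maxHeartbeats 4000000 in
theorem pad_exch (n : ℕ) (F : Finset ℕ → ℝ) (h1 : Q1 n F) (h2 : Q2 n F)
    (S T : Finset ℕ) (hS : S ⊆ range n) (hT : T ⊆ range n) (i : ℕ) (hi : i ∈ S) (hi' : i ∉ T) :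
    (T.card < S.card ∧ F S + F T ≤ F (S.erase i) + F (insert i T)) ∨
      ∃ j ∈ T, j ∉ S ∧ F S + F T ≤ F (insert j (S.erase i)) + F (insert i (T.erase j)) := by
  have hS' : ∀ x ∈ S, x < n := fun x hx => by simpa using hS hx
  have hT' : ∀ x ∈ T, x < n := fun x hx => by simpa using hT hx
  have cS : S.card ≤ n := by simpa using Finset.card_le_card hS
  have cT : T.card ≤ n := by simpa using Finset.card_le_card hT
  have cards : ∀ U : Finset ℕ, (∀ x ∈ U, x < n) → U.card ≤ n →
      (U ∪ Ico n (n + (n - U.card))).card = n := by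
    intro U hU hc
    rw [Finset.card_union_of_disjoint]
    · simp; omega
    · rw [Finset.disjoint_left]; intro x hx hx2
      have := hU x hx
      simp at hx2; omega
  have cA := cards S hS' cS
  have cB := cards T hT' cT
  set A := S ∪ Ico n (n + (n - S.card)) with hA
  set B := T ∪ Ico n (n + (n - T.card)) with hB
  have mA : ∀ x, x ∈ A ↔ x ∈ S ∨ (n ≤ x ∧ x < n + (n - S.card)) := by simp [hA]
  have mB : ∀ x, x ∈ B ↔ x ∈ T ∨ (n ≤ x ∧ x < n + (n - T.card)) := by simp [hB]
  have hin : i < n := hS' i hi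
  obtain ⟨v, hv, hvA, hle⟩ := global_exch _ (p3_of n F h1 h2) (B \ A).card A B rfl
    (Finset.card_sdiff_comm (by omega)) i ((mA i).2 (Or.inl hi)) (by
      rw [mB]; rintro (h | h)
      · exact hi' h
      · omega)
  clear_value A B
  rw [mB] at hv
  rw [mA] at hvA
  have eA : A ∩ range n = S := by
    ext x; have := hS' x; rw [mem_inter, mA, mem_range]; constructor
    · rintro ⟨h | h, h3⟩
      · exact h
      · omega
    · intro h; exact ⟨Or.inl h, this h⟩
  have eB : B ∩ range n = T := by
    ext x; have := hT' x; rw [mem_inter, mB, mem_range]; constructor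
    · rintro ⟨h | h, h3⟩
      · exact h
      · omega
    · intro h; exact ⟨Or.inl h, this h⟩
  simp only [eA, eB] at hle
  by_cases hvn : v < n
  · right
    refine ⟨v, ?_, ?_, ?_⟩
    · rcases hv with h | h
      · exact h
      · omega
    · exact fun h => hvA (Or.inl h)
    · have e1 : insert v (A.erase i) ∩ range n = insert v (S.erase i) := by
        clear hle cards mB; rw [← eA]; ext x; simp only [mem_insert, mem_inter, mem_erase, mem_range]; grind
      have e2 : insert i (B.erase v) ∩ range n = insert i (T.erase v) := by
        clear hle cards mA; rw [← eB]; ext x; simp only [mem_insert, mem_inter, mem_erase, mem_range]; grind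
      rwa [e1, e2] at hle
  · left
    have hvT : v ∉ T := fun h => hvn (hT' v h)
    constructor
    · by_contra! hc
      apply hvA
      right
      rcases hv with h | h
      · exact absurd h hvT
      · omega
    · have e1 : insert v (A.erase i) ∩ range n = S.erase i := by
        clear hle cards mB; rw [← eA]; ext x; simp only [mem_insert, mem_inter, mem_erase, mem_range]; grind
      have e2 : insert i (B.erase v) ∩ range n = insert i T := by
        clear hle cards mA; rw [← eB]; ext x; simp only [mem_insert, mem_inter, mem_erase, mem_range]; grind
      rwa [e1, e2] at hle

theorem mnatconcave_iff_submodular_and_in_flag_dressian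
    (n : ℕ) (F : Finset ℕ → ℝ) :
    MNatConcaveOn n F ↔ (SubmodularOn n F ∧ InFlagDressian n F) := by
  constructor
  · intro h
    have nest : ∀ A ⊆ range n, ∀ B ⊆ A, ∀ i ∈ A, i ∉ B →
        F A + F B ≤ F (A.erase i) + F (insert i B) := by
      intro A hA B hB i hi hi'
      rcases h A hA B (hB.trans hA) i hi hi' with h | ⟨j, hj, hj', _⟩
      · exact h
      · exact absurd (hB hj) hj'
    have q1 : Q1 n F := by
      intro Y hY a b c ha hb hc haY hbY hcY hab hac hbc
      have := h (insert a (insert b Y)) (by grind) (insert c Y) (by grind) a (by grind) (by grind)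
      have e1 : (insert a (insert b Y)).erase a = insert b Y := by ext x; grind
      rw [e1] at this
      rcases this with h | ⟨j, hj, hj', h⟩
      · left; linarith
      · right
        have : j = c := by grind
        subst this
        have e2 : (insert a (insert j Y)).erase j = insert a Y := by ext x; grind
        rw [e2, Finset.insert_comm j b] at h
        linarith
    have q2 : Q2 n F := by
      intro Y hY a b ha hb haY hbY hab
      have := nest (insert a (insert b Y)) (by grind) Y (by grind) a (by grind) haY
      have e1 : (insert a (insert b Y)).erase a = insert b Y := by ext x; grind
      rw [e1] at this
      linarith
    constructor
    · have : ∀ k : ℕ, ∀ S ⊆ range n, ∀ T ⊆ range n, (S \ T).card = k →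
          F (S ∩ T) + F (S ∪ T) ≤ F S + F T := by
        intro k
        induction k with
        | zero =>
          intro S hS T hT hk
          have : S ⊆ T := by rwa [Finset.card_eq_zero, Finset.sdiff_eq_empty_iff_subset] at hk
          rw [Finset.inter_eq_left.2 this, Finset.union_eq_right.2 this]
        | succ k ih =>
          intro S hS T hT hk
          have : (S \ T).Nonempty := by rw [← Finset.card_pos]; omega
          obtain ⟨i, hi⟩ := this
          have hi' := Finset.mem_sdiff.1 hi
          have r1 := ih (S.erase i) (by grind) T hT (by
            rw [Finset.erase_sdiff_comm, Finset.card_erase_of_mem hi]; omega)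
          have r2 := nest (S ∪ T) (by grind) (S.erase i) (by grind) i (by grind) (by grind)
          have e1 : S.erase i ∩ T = S ∩ T := by ext x; grind
          have e2 : S.erase i ∪ T = (S ∪ T).erase i := by ext x; grind
          have e3 : insert i (S.erase i) = S := Finset.insert_erase hi'.1
          rw [e1, e2] at r1
          rw [e3] at r2
          linarith
      intro S hS T hT
      exact this _ S hS T hT rfl
    · intro S hS T hT hc
      have : (T \ S).Nonempty := by
        rw [← Finset.card_pos]
        have := Finset.le_card_sdiff S T
        omega
      obtain ⟨i, hi, hmax⟩ := Finset.exists_max_image (T \ S)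
        (fun i => F (insert i S) + F (T.erase i)) this
      have hi' := Finset.mem_sdiff.1 hi
      have c1 := Finset.card_insert_of_notMem hi'.2
      have c2 := Finset.card_erase_of_mem hi'.1
      rcases pad_exch n F q1 q2 (insert i S) (T.erase i) (by grind) (by grind) i (by grind)
        (by grind) with ⟨hl, _⟩ | ⟨j, hj, hj', hle⟩
      · omega
      · have hjm : j ∈ T \ S := by grind
        have hne : i ≠ j := by grind
        refine ⟨i, hi, j, hjm, hne, ?_, hmax⟩
        have e1 : insert j ((insert i S).erase i) = insert j S := by ext x; grind
        have e2 : insert i ((T.erase i).erase j) = T.erase j := by ext x; grind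
        rw [e1, e2] at hle
        exact le_antisymm hle (hmax j hjm)
  · rintro ⟨hs, hd⟩
    have q1 : Q1 n F := by
      intro Y hY a b c ha hb hc haY hbY hcY hab hac hbc
      have cc : (insert a (insert b (insert c Y))).card = Y.card + 3 := by
        rw [Finset.card_insert_of_notMem (by grind), Finset.card_insert_of_notMem (by grind),
          Finset.card_insert_of_notMem (by grind)]
      obtain ⟨i, hi, j, hj, hij, he, hm⟩ := hd Y hY (insert a (insert b (insert c Y)))
        (by grind) (by omega)
      have e : insert a (insert b (insert c Y)) \ Y = {a, b, c} := by ext x; grind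
      have ea : (insert a (insert b (insert c Y))).erase a = insert b (insert c Y) := by
        ext x; grind
      have eb : (insert a (insert b (insert c Y))).erase b = insert a (insert c Y) := by
        ext x; grind
      have ec : (insert a (insert b (insert c Y))).erase c = insert a (insert b Y) := by
        ext x; grind
      rw [e] at hi hj hm
      have hmc := hm c (by simp)
      simp only [mem_insert, mem_singleton] at hi hj
      rcases hi with rfl | rfl | rfl
      · simp only [ea, ec] at hmc
        right; linarith
      · simp only [eb, ec] at hmc
        left; linarith
      · rcases hj with rfl | rfl | rfl
        · simp only [ea, ec] at he
          right; linarith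
        · simp only [eb, ec] at he
          left; linarith
        · exact absurd rfl hij
    have q2 : Q2 n F := by
      intro Y hY a b ha hb haY hbY hab
      have := hs (insert a Y) (by grind) (insert b Y) (by grind)
      have e1 : insert a Y ∩ insert b Y = Y := by ext x; grind
      have e2 : insert a Y ∪ insert b Y = insert a (insert b Y) := by ext x; grind
      rw [e1, e2] at this
      linarith
    intro S hS T hT i hi hi'
    rcases pad_exch n F q1 q2 S T hS hT i hi hi' with ⟨_, h⟩ | ⟨j, hj, hj', h⟩
    · exact Or.inl h
    · right
      refine ⟨j, hj, hj', ?_⟩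
      have e : (insert i T).erase j = insert i (T.erase j) := by ext x; grind
      rwa [e]
end

section
/- Let F : 2^{[n]} → ℝ be M♮-concave. Then F is strictly submodular if and only if every cell of the regular subdivision of the cube induced by F via upper hull lies in a lattice layer; precisely: for every subset C ⊆ 2^{[n]} for which there exist a ∈ ℝⁿ and b ∈ ℝ with Σ_{i∈S} a_i + b ≥ F(S) for all S ⊆ [n], and with equality holding exactly for the sets S ∈ C, there exists an integer k with k ≤ |S| ≤ k+1 for all S ∈ C. -/
open Finset

/-- Strict submodularity of a function on subsets of the ground set `{0, ..., n-1}`. -/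
def StrictSubmodularOn (n : ℕ) (F : Finset ℕ → ℝ) : Prop :=
  ∀ S ⊆ Finset.range n, ∀ i ∈ Finset.range n, ∀ j ∈ Finset.range n,
    i ∉ S → j ∉ S → i ≠ j →
    F S + F (insert i (insert j S)) < F (insert i S) + F (insert j S)


lemma sdl1 (S T : Finset ℕ) (i : ℕ) : S.erase i \ T = (S \ T).erase i := by
  ext x; simp only [mem_sdiff, mem_erase]; tauto

lemma sdl2 (S T : Finset ℕ) (i : ℕ) (h : i ∉ T) : T \ S.erase i = T \ S := by
  ext x; simp only [mem_sdiff, mem_erase]; grind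

lemma sdl3 (S T : Finset ℕ) (j : ℕ) (h : j ∈ T) : insert j S \ T = S \ T := by
  ext x; simp only [mem_sdiff, mem_insert]; grind

lemma sdl4 (S T : Finset ℕ) (j : ℕ) : T \ insert j S = (T \ S).erase j := by
  ext x; simp only [mem_sdiff, mem_insert, mem_erase]; tauto

lemma sdl5 (S T : Finset ℕ) (j k : ℕ) (h : j ∉ S) :
    S \ insert k (T.erase j) = (S \ T).erase k := by
  ext x; simp only [mem_sdiff, mem_insert, mem_erase]; grind

lemma sdl6 (S T : Finset ℕ) (j k : ℕ) (h : k ∈ S) :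
    insert k (T.erase j) \ S = (T \ S).erase j := by
  ext x; simp only [mem_sdiff, mem_insert, mem_erase]; grind

lemma cell_exchange (n : ℕ) (F : Finset ℕ → ℝ) (hF : MNatConcaveOn n F)
    (a : ℕ → ℝ) (b : ℝ)
    (hle : ∀ S ⊆ Finset.range n, F S ≤ (∑ i ∈ S, a i) + b)
    (S T : Finset ℕ) (hS : S ⊆ Finset.range n) (hT : T ⊆ Finset.range n)
    (eS : (∑ i ∈ S, a i) + b = F S) (eT : (∑ i ∈ T, a i) + b = F T)
    (i : ℕ) (hi : i ∈ S) (hi' : i ∉ T) :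
    (S.erase i ⊆ range n ∧ insert i T ⊆ range n ∧
      (∑ k ∈ S.erase i, a k) + b = F (S.erase i) ∧
      (∑ k ∈ insert i T, a k) + b = F (insert i T)) ∨
    ∃ j ∈ T, j ∉ S ∧ insert j (S.erase i) ⊆ range n ∧
      (∑ k ∈ insert j (S.erase i), a k) + b = F (insert j (S.erase i)) := by
  have s1 : S.erase i ⊆ range n := (erase_subset _ _).trans hS
  have s2 : insert i T ⊆ range n := insert_subset (hS hi) hT
  have q1 := Finset.add_sum_erase S a hi
  have q2 : ∑ k ∈ insert i T, a k = a i + ∑ k ∈ T, a k := sum_insert hi'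
  rcases hF S hS T hT i hi hi' with h | ⟨j, hj, hj', h⟩
  · left
    have h1 := hle _ s1
    have h2 := hle _ s2
    refine ⟨s1, s2, ?_, ?_⟩ <;> linarith
  · right
    have s3 : insert j (S.erase i) ⊆ range n := insert_subset (hT hj) s1
    have s4 : (insert i T).erase j ⊆ range n := (erase_subset _ _).trans s2
    have q3 : ∑ k ∈ insert j (S.erase i), a k = a j + ∑ k ∈ S.erase i, a k :=
      sum_insert (fun h => hj' (mem_of_mem_erase h))
    have q4 := Finset.add_sum_erase (insert i T) a (mem_insert_of_mem hj)
    have h1 := hle _ s3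
    have h2 := hle _ s4
    refine ⟨j, hj, hj', s3, ?_⟩
    linarith

lemma cell_key (n : ℕ) (F : Finset ℕ → ℝ) (hF : MNatConcaveOn n F)
    (hs : StrictSubmodularOn n F) (a : ℕ → ℝ) (b : ℝ)
    (hle : ∀ S ⊆ Finset.range n, F S ≤ (∑ i ∈ S, a i) + b) (m : ℕ) :
    ∀ (S T : Finset ℕ), S ⊆ Finset.range n → T ⊆ Finset.range n →
    (∑ i ∈ S, a i) + b = F S → (∑ i ∈ T, a i) + b = F T →
    #(S \ T) + #(T \ S) = m → #T + 2 ≤ #S → False := by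
  induction m using Nat.strong_induction_on with
  | _ m ih =>
  intro S T hS hT eS eT hm hc
  by_cases hTS : T ⊆ S
  · have hcard : #(S \ T) + #T = #S := card_sdiff_add_card_eq_card hTS
    obtain ⟨i, hi, j, hj, hij⟩ : ∃ i ∈ S \ T, ∃ j ∈ S \ T, i ≠ j := by
      apply one_lt_card.mp; omega
    rw [mem_sdiff] at hi hj
    rcases cell_exchange n F hF a b hle S T hS hT eS eT i hi.1 hi.2 with
      ⟨s1, s2, e1, e2⟩ | ⟨k, hk, hk', _⟩
    · by_cases h3 : #T + 3 ≤ #S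
      · refine ih _ ?_ (S.erase i) T s1 hT e1 eT rfl ?_
        · have h1 : S.erase i \ T = (S \ T).erase i := sdl1 _ _ _
          have h2 : T \ S.erase i = T \ S := sdl2 _ _ _ hi.2
          have := card_erase_lt_of_mem (mem_sdiff.mpr hi)
          rw [h1, h2]; omega
        · rw [card_erase_of_mem hi.1]; omega
      · have hEq : insert i (insert j T) = S := by
          apply eq_of_subset_of_card_le
          · grind
          · rw [card_insert_of_notMem (by grind), card_insert_of_notMem hj.2]; omega
        have h := hs T hT i (hS hi.1) j (hS hj.1) hi.2 hj.2 hij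
        have h1 := hle (insert i T) s2
        have h2 := hle (insert j T) (insert_subset (hS hj.1) hT)
        rw [sum_insert hi.2] at h1
        rw [sum_insert hj.2] at h2
        have h3 : ∑ k ∈ insert i (insert j T), a k = a i + (a j + ∑ k ∈ T, a k) := by
          rw [sum_insert (by grind), sum_insert hj.2]
        rw [hEq] at h h3
        linarith
    · exact hk' (hTS hk)
  · obtain ⟨j, hj, hj'⟩ := not_subset.mp hTS
    rcases cell_exchange n F hF a b hle T S hT hS eT eS j hj hj' with
      ⟨s1, s2, e1, e2⟩ | ⟨k, hk, hk', s, e⟩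
    · refine ih _ ?_ (insert j S) T s2 hT e2 eT rfl ?_
      · have h1 : insert j S \ T = S \ T := sdl3 _ _ _ hj
        have h2 : T \ insert j S = (T \ S).erase j := sdl4 _ _ _
        have := card_erase_lt_of_mem (mem_sdiff.mpr ⟨hj, hj'⟩)
        rw [h1, h2]; omega
      · rw [card_insert_of_notMem hj']; omega
    · refine ih _ ?_ S (insert k (T.erase j)) hS s eS e rfl ?_
      · have h1 : S \ insert k (T.erase j) = (S \ T).erase k := sdl5 _ _ _ _ hj'
        have h2 : insert k (T.erase j) \ S = (T \ S).erase j := sdl6 _ _ _ _ hk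
        have := card_erase_lt_of_mem (mem_sdiff.mpr ⟨hj, hj'⟩)
        have := card_erase_lt_of_mem (mem_sdiff.mpr ⟨hk, hk'⟩)
        rw [h1, h2]; omega
      · have := card_pos.mpr ⟨j, hj⟩
        rw [card_insert_of_notMem (fun h => hk' (mem_of_mem_erase h)), card_erase_of_mem hj]; omega

lemma face_support (n : ℕ) (F : Finset ℕ → ℝ) (S : Finset ℕ) (hS : S ⊆ range n)
    (i j : ℕ) (hi : i ∈ range n) (hj : j ∈ range n) (hiS : i ∉ S) (hjS : j ∉ S) (hij : i ≠ j)
    (heq : F S + F (insert i (insert j S)) = F (insert i S) + F (insert j S)) :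
    ∃ (a : ℕ → ℝ) (b : ℝ), (∀ S ⊆ Finset.range n, F S ≤ (∑ i ∈ S, a i) + b) ∧
      (∑ k ∈ S, a k) + b = F S ∧
      (∑ k ∈ insert i (insert j S), a k) + b = F (insert i (insert j S)) := by
  set α := F (insert i S) - F S with hα
  set β := F (insert j S) - F S with hβ
  set M := |α| + |β| + ∑ U ∈ (range n).powerset, |F U| + |F S| with hM
  have hsum0 : 0 ≤ ∑ U ∈ (range n).powerset, |F U| := sum_nonneg (fun _ _ => abs_nonneg _)
  have hM0 : 0 ≤ M := by positivity
  let a : ℕ → ℝ := fun k => if k = i then α else if k = j then β else if k ∈ S then -M else M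
  have ai : a i = α := by simp [a]
  have aj : a j = β := by simp [a, hij.symm]
  have sij : ∑ k ∈ insert i (insert j S), a k = α + (β + ∑ k ∈ S, a k) := by
    rw [sum_insert (by grind), sum_insert hjS, ai, aj]
  refine ⟨a, F S - ∑ k ∈ S, a k, ?_, by ring, by rw [sij]; linarith⟩
  intro U hU
  by_cases hd : ∃ k ∈ range n, k ≠ i ∧ k ≠ j ∧ ¬ (k ∈ U ↔ k ∈ S)
  · obtain ⟨k, hk, hki, hkj, hne⟩ := hd
    let d : ℕ → ℝ := fun k => (if k ∈ U then a k else 0) - (if k ∈ S then a k else 0)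
    have hsum : ∑ k ∈ U, a k - ∑ k ∈ S, a k = ∑ k ∈ range n, d k := by
      simp only [d, sum_sub_distrib]
      rw [← sum_filter, ← sum_filter, filter_mem_eq_inter, filter_mem_eq_inter,
        inter_eq_right.mpr hU, inter_eq_right.mpr hS]
    have hsub : ∑ l ∈ ({i, j, k} : Finset ℕ), d l ≤ ∑ l ∈ range n, d l := by
      apply sum_le_sum_of_subset_of_nonneg
      · intro x hx; simp only [mem_insert, mem_singleton] at hx
        rcases hx with rfl | rfl | rfl <;> assumption
      · intro l _ hl
        simp only [mem_insert, mem_singleton, not_or] at hl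
        simp only [d, a, hl.1, hl.2.1, if_false]
        split_ifs <;> linarith
    rw [sum_insert (by simp [hij, hki.symm]), sum_insert (by simp [hkj.symm]),
      sum_singleton] at hsub
    have hdk : d k = M := by
      simp only [d, a, hki, hkj, if_false]
      by_cases h1 : k ∈ U <;> by_cases h2 : k ∈ S <;> simp_all
    have hdi : -|α| ≤ d i := by
      have := neg_abs_le α
      have := abs_nonneg α
      simp only [d, ai, hiS, if_false]
      split_ifs <;> linarith
    have hdj : -|β| ≤ d j := by
      have := neg_abs_le β
      have := abs_nonneg β
      simp only [d, aj, hjS, if_false]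
      split_ifs <;> linarith
    have hFU : |F U| ≤ ∑ U ∈ (range n).powerset, |F U| :=
      single_le_sum (f := fun U => |F U|) (fun _ _ => abs_nonneg _) (mem_powerset.mpr hU)
    have := le_abs_self (F U)
    have := neg_abs_le (F S)
    linarith
  · push Not at hd
    by_cases h1 : i ∈ U <;> by_cases h2 : j ∈ U
    · have : U = insert i (insert j S) := by ext x; grind
      rw [this, sij]; linarith
    · have : U = insert i S := by ext x; grind
      rw [this, sum_insert hiS, ai]; linarith
    · have : U = insert j S := by ext x; grind
      rw [this, sum_insert hjS, aj]; linarith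
    · have : U = S := by ext x; grind
      rw [this]; linarith

/-- A function `F` on subsets of `{0, ..., n-1}`, which is M♮-concave, is strictly
submodular iff every cell of the regular subdivision of the cube induced by `F` via
upper hull (i.e., every equality set of an affine function lying weakly above the
lift of the cube vertices) lies in a lattice layer `k ≤ |S| ≤ k+1`. -/
theorem strictSubmodular_iff_cells_in_layers
    (n : ℕ) (F : Finset ℕ → ℝ) (hF : MNatConcaveOn n F) :
    StrictSubmodularOn n F ↔
      ∀ C : Set (Finset ℕ), (∀ S ∈ C, S ⊆ Finset.range n) →
        (∃ (a : ℕ → ℝ) (b : ℝ),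
          (∀ S ⊆ Finset.range n, F S ≤ (∑ i ∈ S, a i) + b) ∧
          (∀ S ⊆ Finset.range n, (S ∈ C ↔ (∑ i ∈ S, a i) + b = F S))) →
        ∃ k : ℤ, ∀ S ∈ C, k ≤ (S.card : ℤ) ∧ (S.card : ℤ) ≤ k + 1 := by
  constructor
  · rintro hs C hC ⟨a, b, hle, heq⟩
    by_cases hne : ∃ S, S ∈ C
    · classical
      have hex : ∃ m, ∃ S ∈ C, #S = m := by
        obtain ⟨S, hS⟩ := hne
        exact ⟨_, S, hS, rfl⟩
      obtain ⟨T, hT, hTm⟩ := Nat.find_spec hex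
      refine ⟨(#T : ℤ), fun S hS => ⟨?_, ?_⟩⟩
      · have := Nat.find_min' hex ⟨S, hS, rfl⟩
        omega
      · by_contra hcon
        exact cell_key n F hF hs a b hle _ S T (hC S hS) (hC T hT)
          ((heq S (hC S hS)).mp hS) ((heq T (hC T hT)).mp hT) rfl (by omega)
    · exact ⟨0, fun S hS => absurd ⟨S, hS⟩ hne⟩
  · intro h S hS i hi j hj hiS hjS hij
    by_contra hlt
    have hsub : insert i (insert j S) ⊆ range n := insert_subset hi (insert_subset hj hS)
    have heq : F S + F (insert i (insert j S)) = F (insert i S) + F (insert j S) := by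
      apply le_antisymm _ (not_lt.mp hlt)
      rcases hF _ hsub S hS i (mem_insert_self _ _) hiS with h1 | ⟨k, hk, hk', _⟩
      · rw [erase_insert (by grind)] at h1
        linarith
      · exact absurd (by grind) hk'
    obtain ⟨a, b, hle, e1, e2⟩ := face_support n F S hS i j hi hj hiS hjS hij heq
    obtain ⟨k, hk⟩ := h {U | U ⊆ range n ∧ (∑ i ∈ U, a i) + b = F U} (fun _ h => h.1)
      ⟨a, b, hle, fun U hU => ⟨fun h => h.2, fun h => ⟨hU, h⟩⟩⟩
    have h1 := hk S ⟨hS, e1⟩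
    have h2 := hk _ ⟨hsub, e2⟩
    rw [card_insert_of_notMem (by grind), card_insert_of_notMem hjS] at h2
    push_cast at h2
    omega
end

section
/- Let Γ ⊆ ℝ be a nontrivial additive subgroup (Γ ≠ {0}) and n ≥ 1. For every function w : 2^{[n]} → ℝ there exist λ_0, λ_1, ..., λ_n ∈ Γ such that the function S ↦ λ_{|S|} + w(S) is strictly submodular. Moreover, if w is submodular and Γ is dense in ℝ, then for every ε > 0 such λ_0,...,λ_n can be chosen with |λ_k| < ε for all k = 0,...,n. -/
open Finset

theorem aux_strict (n : ℕ) (w : Finset ℕ → ℝ) (g : ℝ)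
    (h : ∀ S ⊆ Finset.range n, ∀ i ∈ Finset.range n, ∀ j ∈ Finset.range n,
      i ∉ S → j ∉ S → i ≠ j →
      w S + w (insert i (insert j S)) < w (insert i S) + w (insert j S) + 2 * g) :
    StrictSubmodularOn n (fun S => (fun k : ℕ => -((k : ℝ) ^ 2 * g)) S.card + w S) := by
  intro S hS i hi j hj hiS hjS hij
  have h1 := h S hS i hi j hj hiS hjS hij
  have c3 : i ∉ insert j S := by simp [hij, hiS]
  simp only [Finset.card_insert_of_notMem c3, Finset.card_insert_of_notMem hiS,
    Finset.card_insert_of_notMem hjS]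
  push_cast
  nlinarith

theorem aux_mem (Γ : AddSubgroup ℝ) (g : ℝ) (hg : g ∈ Γ) (k : ℕ) :
    -((k : ℝ) ^ 2 * g) ∈ Γ := by
  have := Γ.neg_mem (Γ.nsmul_mem hg (k ^ 2))
  simpa [nsmul_eq_mul] using this

theorem tropical_scaling_to_strict_submodularity
    (Γ : AddSubgroup ℝ) (hΓ : Γ ≠ ⊥) (n : ℕ) (hn : 1 ≤ n) :
    (∀ w : Finset ℕ → ℝ, ∃ lam : ℕ → ℝ, (∀ k ≤ n, lam k ∈ Γ) ∧
        StrictSubmodularOn n (fun S => lam S.card + w S)) ∧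
    (∀ w : Finset ℕ → ℝ, SubmodularOn n w → Dense (Γ : Set ℝ) →
      ∀ ε : ℝ, 0 < ε →
        ∃ lam : ℕ → ℝ, (∀ k ≤ n, lam k ∈ Γ) ∧ (∀ k ≤ n, |lam k| < ε) ∧
          StrictSubmodularOn n (fun S => lam S.card + w S)) := by
  constructor
  · intro w
    obtain ⟨a, ha, ha0⟩ := Γ.bot_or_exists_ne_zero.resolve_left hΓ
    have hb : |a| ∈ Γ := by
      rcases abs_choice a with h | h <;> rw [h]
      · exact ha
      · exact Γ.neg_mem ha
    have hpos : 0 < |a| := abs_pos.2 ha0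
    set B := ∑ S ∈ (Finset.range n).powerset, |w S| with hB
    have hw : ∀ S ⊆ Finset.range n, |w S| ≤ B := fun S hS =>
      Finset.single_le_sum (f := fun S => |w S|) (fun _ _ => abs_nonneg _)
        (Finset.mem_powerset.2 hS)
    obtain ⟨m, hm⟩ := Archimedean.arch (2 * B + 1) hpos
    refine ⟨fun k => -((k : ℝ) ^ 2 * (m • |a|)),
      fun k _ => aux_mem Γ _ (Γ.nsmul_mem hb m) k, aux_strict n w _ ?_⟩
    intro S hS i hi j hj _ _ _
    have hjS := Finset.insert_subset hj hS
    have h1 := abs_le.1 (hw S hS)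
    have h2 := abs_le.1 (hw _ (Finset.insert_subset hi hS))
    have h3 := abs_le.1 (hw _ hjS)
    have h4 := abs_le.1 (hw _ (Finset.insert_subset hi hjS))
    linarith [h1.2, h2.1, h3.1, h4.2]
  · intro w hw hd ε hε
    have hp : 0 < ε / ((n : ℝ) ^ 2 + 1) := by positivity
    obtain ⟨g, hg, hg0, hg1⟩ := hd.exists_between hp
    rw [lt_div_iff₀ (by positivity)] at hg1
    refine ⟨fun k => -((k : ℝ) ^ 2 * g), fun k _ => aux_mem Γ g hg k, ?_, aux_strict n w _ ?_⟩
    · intro k hk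
      have hk' : (k : ℝ) ≤ n := by exact_mod_cast hk
      have h2 : (k : ℝ) ^ 2 ≤ (n : ℝ) ^ 2 := by gcongr
      have h3 := mul_le_mul_of_nonneg_right h2 hg0.le
      simp only [abs_neg]
      rw [abs_of_nonneg (by positivity)]
      nlinarith
    · intro S hS i hi j hj hiS hjS hij
      have h := hw _ (Finset.insert_subset hi hS) _ (Finset.insert_subset hj hS)
      have e1 : insert i S ∩ insert j S = S := by
        ext x; simp only [Finset.mem_inter, Finset.mem_insert]; grind
      have e2 : insert i S ∪ insert j S = insert i (insert j S) := by
        ext x; simp only [Finset.mem_union, Finset.mem_insert]; tauto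
      rw [e1, e2] at h
      linarith
end

section
/- Let K be a field with a valuation-like map ν, and let B be an upper triangular n×n matrix over K (B_{ij} = 0 whenever i > j) such that det B({1,...,|S|}, S) ≠ 0 for every S ⊆ [n], and such that the function 2^{[n]} → ℝ given by S ↦ ν(det B({1,...,|S|}, S)) is submodular. Then for all S,T ⊆ [n] with |S| = |T|, ν(det B({1,...,|S|}, S)) ≥ ν(det B(T,S)). -/
open Finset

/-- The determinant of the square submatrix of `B` with rows indexed by `T` and
columns indexed by `S` (each taken in increasing order); `0` if `T.card ≠ S.card`. -/
noncomputable def subDet {K : Type*} [CommRing K] {n : ℕ}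
    (B : Matrix (Fin n) (Fin n) K) (T S : Finset (Fin n)) : K :=
  if h : T.card = S.card then
    (Matrix.of fun i j : Fin S.card =>
      B (T.orderEmbOfFin h i) (S.orderEmbOfFin rfl j)).det
  else 0

/-- The set of the first `k` elements of `Fin n`, playing the role of `{1, ..., k}`. -/
def firstK (n k : ℕ) : Finset (Fin n) :=
  Finset.univ.filter fun i => (i : ℕ) < k

structure VL {K : Type*} [Field K] (ν : K → WithBot ℝ) : Prop where
  z : ∀ x : K, ν x = ⊥ ↔ x = 0
  mul : ∀ a b : K, ν (a * b) = ν a + ν b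
  add : ∀ a b : K, ν (a + b) ≤ max (ν a) (ν b)

namespace VL

variable {K : Type*} [Field K] {ν : K → WithBot ℝ}

theorem zero (h : VL ν) : ν 0 = ⊥ := (h.z 0).2 rfl

theorem ex (h : VL ν) {x : K} (hx : x ≠ 0) : ∃ r : ℝ, ν x = (r : WithBot ℝ) := by
  have : ν x ≠ ⊥ := fun h' => hx ((h.z x).1 h')
  exact ⟨(ν x).unbot this, (WithBot.coe_unbot _ _).symm⟩

theorem ne (h : VL ν) {x : K} {r : ℝ} (hx : ν x = (r : WithBot ℝ)) : x ≠ 0 := by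
  rintro rfl
  rw [h.zero] at hx
  exact WithBot.coe_ne_bot hx.symm

theorem one (h : VL ν) : ν 1 = ((0 : ℝ) : WithBot ℝ) := by
  obtain ⟨r, hr⟩ := h.ex (one_ne_zero : (1 : K) ≠ 0)
  have := h.mul 1 1
  rw [mul_one, hr] at this
  norm_cast at this
  rw [hr]
  norm_cast
  linarith

theorem negone (h : VL ν) : ν (-1) = ((0 : ℝ) : WithBot ℝ) := by
  obtain ⟨r, hr⟩ := h.ex (neg_ne_zero.2 one_ne_zero : (-1 : K) ≠ 0)
  have := h.mul (-1) (-1)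
  rw [neg_mul_neg, mul_one, hr, h.one] at this
  norm_cast at this
  rw [hr]
  norm_cast
  linarith

theorem neg (h : VL ν) (x : K) : ν (-x) = ν x := by
  rw [← neg_one_mul, h.mul, h.negone]
  simp

theorem npow (h : VL ν) (m : ℕ) (x : K) : ν ((-1) ^ m * x) = ν x := by
  rcases neg_one_pow_eq_or K m with h' | h' <;> rw [h']
  · simp
  · rw [neg_one_mul, h.neg]

theorem sgn (h : VL ν) {k : ℕ} (σ : Equiv.Perm (Fin k)) (x : K) :
    ν (((Equiv.Perm.sign σ : ℤ) : K) * x) = ν x := by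
  rcases Int.units_eq_one_or (Equiv.Perm.sign σ) with h' | h' <;> rw [h']
  · simp
  · simp [h.neg]

theorem sum (h : VL ν) {ι : Type*} (s : Finset ι) (g : ι → K) (M : WithBot ℝ)
    (hM : ∀ i ∈ s, ν (g i) ≤ M) : ν (∑ i ∈ s, g i) ≤ M := by
  classical
  induction s using Finset.induction_on with
  | empty => simp [h.zero]
  | insert a s ha ih =>
    rw [Finset.sum_insert ha]
    refine (h.add _ _).trans (max_le (hM _ (by simp)) (ih fun i hi => hM i (by simp [hi])))

theorem prod_le (h : VL ν) {ι : Type*} (s : Finset ι) (g : ι → K)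
    (hM : ∀ i ∈ s, ν (g i) ≤ ((0 : ℝ) : WithBot ℝ)) :
    ν (∏ i ∈ s, g i) ≤ ((0 : ℝ) : WithBot ℝ) := by
  classical
  induction s using Finset.induction_on with
  | empty => simp [h.one]
  | insert a s ha ih =>
    rw [Finset.prod_insert ha, h.mul]
    have h1 := hM a (by simp)
    have h2 := ih fun i hi => hM i (by simp [hi])
    calc _ ≤ ((0 : ℝ) : WithBot ℝ) + ((0 : ℝ) : WithBot ℝ) := add_le_add h1 h2
      _ = _ := by simp

/-- expanding rows -/
theorem expand (h : VL ν) {k : ℕ} (a b : Fin k → Fin k → K) (c : Fin k → K)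
    (hc : ∀ i, ν (c i) ≤ ((0 : ℝ) : WithBot ℝ)) (M : WithBot ℝ)
    (hM : ∀ S : Finset (Fin k), ν (Matrix.det (Matrix.of (S.piecewise b a))) ≤ M) :
    ν (Matrix.det (Matrix.of fun i j => c i * b i j + a i j)) ≤ M := by
  have e : Matrix.det (Matrix.of fun i j => c i * b i j + a i j)
      = ∑ S : Finset (Fin k), (∏ i ∈ S, c i) * Matrix.det (Matrix.of (S.piecewise b a)) := by
    have := (Matrix.detRowAlternating (R := K) (n := Fin k)).toMultilinearMap.map_add_univ
      (fun i => c i • b i) a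
    refine Eq.trans ?_ (this.trans (Finset.sum_congr rfl fun S _ => ?_))
    · rfl
    · have h2 := (Matrix.detRowAlternating (R := K) (n := Fin k)).toMultilinearMap.map_piecewise_smul
        c (S.piecewise b a) S
      have h3 : S.piecewise (fun i => c i • b i) a =
          S.piecewise (fun i => c i • S.piecewise b a i) (S.piecewise b a) := by
        funext i
        by_cases hi : i ∈ S <;> simp [hi]
      rw [h3]
      exact h2
  rw [e]
  refine h.sum _ _ _ fun S _ => ?_
  rw [h.mul]
  calc _ ≤ ((0 : ℝ) : WithBot ℝ) + M := add_le_add (h.prod_le _ _ fun i _ => hc i) (hM S)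
    _ = M := by simp

/-- hypothesis on principal flags -/
def HF (ν : K → WithBot ℝ) (n : ℕ) (A : ℕ → ℕ → K) (f : Finset ℕ → ℝ) : Prop :=
  ∀ (k : ℕ) (s : Fin k → ℕ), Function.Injective s → (∀ i, s i < n) →
    ν (Matrix.det (Matrix.of fun i j : Fin k => A i (s j))) = ((f (univ.image s) : ℝ) : WithBot ℝ)

theorem det_tri (A : ℕ → ℕ → K) (m : ℕ) (hA : ∀ i < m, ∀ j < i, A i j = 0) :
    Matrix.det (Matrix.of fun i j : Fin m => A i j) = ∏ i ∈ range m, A i i := by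
  have : Matrix.BlockTriangular (Matrix.of fun i j : Fin m => A i j) id := by
    intro i j hij
    exact hA i i.2 j hij
  have h2 := Matrix.det_of_isUpperTriangular this
  rw [← Fin.prod_univ_eq_prod_range (fun i => A i i)]
  exact h2

theorem image_val (m : ℕ) : (univ.image fun i : Fin m => (i : ℕ)) = range m := by
  ext x
  simp only [mem_image, mem_univ, true_and, mem_range]
  exact ⟨fun ⟨i, hi⟩ => hi ▸ i.2, fun hx => ⟨⟨x, hx⟩, rfl⟩⟩

theorem prod_tri {n : ℕ} {A : ℕ → ℕ → K} {f : Finset ℕ → ℝ} (hf : HF ν n A f)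
    (m : ℕ) (hm : m ≤ n) (hA : ∀ i < m, ∀ j < i, A i j = 0) :
    ν (∏ i ∈ range m, A i i) = ((f (range m) : ℝ) : WithBot ℝ) := by
  rw [← det_tri A m hA, ← image_val]
  exact hf m (fun i => i) Fin.val_injective (fun i => i.2.trans_le hm)

theorem diag (h : VL ν) {n : ℕ} {A : ℕ → ℕ → K} {f : Finset ℕ → ℝ} (hf : HF ν n A f)
    (m : ℕ) (hm : m < n) (hA : ∀ i < m + 1, ∀ j < i, A i j = 0) :
    ν (A m m) = ((f (range (m + 1)) - f (range m) : ℝ) : WithBot ℝ) := by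
  have h1 := prod_tri hf (m + 1) hm hA
  have h2 := prod_tri hf m hm.le fun i hi => hA i (by omega)
  rw [prod_range_succ] at h1
  have h3 := h.ne h1
  obtain ⟨r, hr⟩ := h.ex (right_ne_zero_of_mul h3)
  rw [h.mul, h2, hr] at h1
  rw [hr]
  norm_cast at h1 ⊢
  linarith

/-- the eliminated matrix -/
noncomputable def P (A : ℕ → ℕ → K) : ℕ → ℕ → K
  | 0, j => A 0 (j + 1)
  | i + 1, j => A (i + 1) (j + 1) - A (i + 1) (i + 1) / P A i i * P A i j

theorem det_P (A : ℕ → ℕ → K) (k : ℕ) (s : Fin k → ℕ) :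
    Matrix.det (Matrix.of fun i j : Fin k => P A i (s j)) =
      Matrix.det (Matrix.of fun i j : Fin k => A i (s j + 1)) := by
  cases k with
  | zero => simp
  | succ k =>
    refine Matrix.det_eq_of_forall_row_eq_smul_add_pred
      (fun i => - (A (i + 1) (i + 1) / P A i i)) ?_ ?_
    · intro j; simp [P]
    · intro i j; simp [P]; ring

theorem main (h : VL ν) (n : ℕ) : ∀ (A : ℕ → ℕ → K) (f : Finset ℕ → ℝ),
    (∀ i < n, ∀ j < i, A i j = 0) → HF ν n A f →
    (∀ S T, f (S ∩ T) + f (S ∪ T) ≤ f S + f T) →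
    ∀ (k : ℕ) (t s : Fin k → ℕ), Function.Injective s → (∀ i, s i < n) → (∀ i, t i < n) →
      ν (Matrix.det (Matrix.of fun i j : Fin k => A (t i) (s j))) ≤ ((f (univ.image s) : ℝ) : WithBot ℝ) := by
  induction n with
  | zero =>
    intro A f hA hf hsub k t s hs hsn htn
    cases k with
    | zero =>
      rw [← hf 0 s hs hsn]; simp
    | succ k => exact absurd (hsn 0) (by omega)
  | succ n ih =>
    intro A f hA hf hsub k t s hs hsn htn
    have hsucc : Function.Injective (fun x : ℕ => x + 1) := add_left_injective 1
    by_cases h0 : ∃ j0, s j0 = 0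
    · obtain ⟨j0, hj0⟩ := h0
      cases k with
      | zero => exact j0.elim0
      | succ k =>
      by_cases ht : Function.Injective t
      swap
      · have : Matrix.det (Matrix.of fun i j : Fin (k + 1) => A (t i) (s j)) = 0 := by
          simp only [Function.Injective, not_forall] at ht
          obtain ⟨a, b, hab, hne⟩ := ht
          exact Matrix.det_zero_of_row_eq hne (by funext j; simp [hab])
        rw [this, h.zero]; exact bot_le
      by_cases hi0 : ∃ i0, t i0 = 0
      swap
      · have : Matrix.det (Matrix.of fun i j : Fin (k + 1) => A (t i) (s j)) = 0 := by
          refine Matrix.det_eq_zero_of_column_eq_zero j0 fun i => ?_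
          rw [Matrix.of_apply, hj0]
          exact hA _ (htn i) _ (Nat.pos_of_ne_zero fun hh => hi0 ⟨i, hh⟩)
        rw [this, h.zero]; exact bot_le
      obtain ⟨i0, hi0⟩ := hi0
      have e : Matrix.det (Matrix.of fun i j : Fin (k + 1) => A (t i) (s j)) =
          (-1) ^ (i0 + j0 : ℕ) * A 0 0 * Matrix.det
            (Matrix.of fun i j : Fin k => A (t (i0.succAbove i)) (s (j0.succAbove j))) := by
        rw [Matrix.det_succ_column _ j0, Finset.sum_eq_single i0]
        · rw [Matrix.of_apply, hi0, hj0]; rfl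
        · intro i _ hi
          have : t i ≠ 0 := fun hh => hi (ht (hh.trans hi0.symm))
          rw [Matrix.of_apply, hj0, hA _ (htn i) 0 (Nat.pos_of_ne_zero this)]
          simp
        · simp
      have hA00 : ν (A 0 0) = ((f {0} : ℝ) : WithBot ℝ) := by
        have := hf 1 (fun _ => 0) (fun a b _ => Subsingleton.elim _ _) (by simp)
        simpa using this
      have hn0 := h.ne hA00
      let f' : Finset ℕ → ℝ := fun S => f (insert 0 (S.image fun x => x + 1)) - f {0}
      have key := ih (fun i j => A (i + 1) (j + 1)) f'
        (fun i hi j hj => hA _ (by omega) _ (by omega)) ?_ ?_ k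
        (fun i => t (i0.succAbove i) - 1) (fun j => s (j0.succAbove j) - 1) ?_ ?_ ?_
      rotate_left
      · intro k s hs hsn
        have := hf (k + 1) (Fin.cons 0 fun i => s i + 1) ?_ ?_
        rotate_left
        · rw [Fin.cons_injective_iff]
          exact ⟨by simp, hsucc.comp hs⟩
        · intro i
          refine Fin.cases ?_ (fun i => ?_) i
          · simp
          · simpa using hsn i
        rw [Matrix.det_succ_column_zero, Finset.sum_eq_single 0] at this
        · simp only [Fin.val_zero, pow_zero, one_mul, Matrix.of_apply, Fin.cons_zero] at this
          rw [h.mul, hA00] at this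
          have e2 : (univ.image (Fin.cons 0 fun i => s i + 1 : Fin (k + 1) → ℕ)) =
              insert 0 ((univ.image s).image fun x => x + 1) := by
            ext x
            simp [Fin.exists_fin_succ, eq_comm]
          have e3 : Matrix.det (Matrix.submatrix (Matrix.of fun i j : Fin (k + 1) =>
              A i ((Fin.cons 0 fun i => s i + 1 : Fin (k + 1) → ℕ) j)) (Fin.succAbove 0) Fin.succ)
              = Matrix.det (Matrix.of fun i j : Fin k => A (i + 1) (s j + 1)) := by
            congr 1
          rw [e2, e3] at this
          generalize ν (Matrix.det (Matrix.of fun i j : Fin k => A (i + 1) (s j + 1))) = z at this ⊢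
          cases z with
          | bot => simp at this
          | coe z =>
            simp only [f']
            norm_cast at this ⊢
            linarith
        · intro i _ hi
          have hk : k ≤ n := by
            have := Fintype.card_le_of_injective (fun j => (⟨s j, hsn j⟩ : Fin n))
              (fun a b hab => hs (by simpa using hab))
            simpa using this
          have := hA i (by omega) 0 (Nat.pos_of_ne_zero fun hh => hi (Fin.ext hh))
          simp [this]
        · simp
      · intro S T
        have := hsub (insert 0 (S.image fun x => x + 1)) (insert 0 (T.image fun x => x + 1))
        rw [← Finset.insert_inter_distrib, ← Finset.insert_union_distrib,
          ← Finset.image_inter _ _ hsucc, ← Finset.image_union] at this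
        simp only [f']
        linarith
      · intro a b hab
        have h1 : s (j0.succAbove a) ≠ 0 := fun hh =>
          Fin.succAbove_ne j0 a (hs (hh.trans hj0.symm))
        have h2 : s (j0.succAbove b) ≠ 0 := fun hh =>
          Fin.succAbove_ne j0 b (hs (hh.trans hj0.symm))
        simp only at hab
        exact Fin.succAbove_right_injective (p := j0) (hs (by omega))
      · intro a
        have h1 : s (j0.succAbove a) ≠ 0 := fun hh =>
          Fin.succAbove_ne j0 a (hs (hh.trans hj0.symm))
        have := hsn (j0.succAbove a)
        omega
      · intro a
        have h1 : t (i0.succAbove a) ≠ 0 := fun hh =>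
          Fin.succAbove_ne i0 a (ht (hh.trans hi0.symm))
        have := htn (i0.succAbove a)
        omega
      have hs1 : ∀ a, s (j0.succAbove a) - 1 + 1 = s (j0.succAbove a) := fun a => by
        have h1 : s (j0.succAbove a) ≠ 0 := fun hh =>
          Fin.succAbove_ne j0 a (hs (hh.trans hj0.symm))
        omega
      have ht1 : ∀ a, t (i0.succAbove a) - 1 + 1 = t (i0.succAbove a) := fun a => by
        have h1 : t (i0.succAbove a) ≠ 0 := fun hh =>
          Fin.succAbove_ne i0 a (ht (hh.trans hi0.symm))
        omega
      simp only [hs1, ht1] at key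
      rw [e, mul_assoc, h.npow, h.mul, hA00]
      refine (add_le_add le_rfl key).trans ?_
      have e2 : insert 0 ((univ.image fun j => s (j0.succAbove j) - 1).image fun x => x + 1) =
          univ.image s := by
        rw [Finset.image_image]
        simp only [Function.comp_def, hs1]
        ext x
        simp only [mem_insert, mem_image, mem_univ, true_and]
        rw [Fin.exists_iff_succAbove j0, hj0, eq_comm]
      simp only [f', e2]
      norm_cast
      linarith
    · have hs0 : ∀ j, s j - 1 + 1 = s j := fun j => by
        have : s j ≠ 0 := fun hh => h0 ⟨j, hh⟩
        omega
      let f' : Finset ℕ → ℝ := fun S => f (S.image fun x => x + 1)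
      have hfP : HF ν n (P A) f' := by
        intro k s hs hsn
        rw [det_P, hf k (fun j => s j + 1) (hsucc.comp hs) (fun i => by have := hsn i; omega)]
        simp only [f', Finset.image_image, Function.comp_def]
      have hPup : ∀ m ≤ n, ∀ i < m + 1, ∀ j < i, P A i j = 0 := by
        intro m
        induction m with
        | zero => intro _ i hi j hj; omega
        | succ m ihm =>
          intro hm i hi j hj
          by_cases him : i < m + 1
          · exact ihm (by omega) i him j hj
          obtain rfl : i = m + 1 := by omega
          have hne := h.ne (diag h hfP m (by omega) (ihm (by omega)))
          simp only [P]
          by_cases hjm : j = m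
          · subst hjm
            rw [div_mul_cancel₀ _ hne, sub_self]
          · rw [ihm (by omega) m (by omega) j (by omega), hA (m + 1) (by omega) _ (by omega)]
            simp
      have key := ih (P A) f' (hPup n le_rfl |> fun hh i hi => hh i (Nat.lt_succ_of_lt hi)) hfP (by
        intro S T
        have := hsub (S.image fun x => x + 1) (T.image fun x => x + 1)
        rwa [← Finset.image_inter _ _ hsucc, ← Finset.image_union] at this)
      let c : ℕ → K := fun i => if i = 0 then 0 else A i i / P A (i - 1) (i - 1)
      have hc : ∀ i < n + 1, ν (c i) ≤ ((0 : ℝ) : WithBot ℝ) := by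
        intro i hi
        cases i with
        | zero => simp [c, h.zero]
        | succ i =>
          simp only [c, Nat.add_sub_cancel, Nat.succ_ne_zero, if_false]
          have h1 := diag h hfP i (by omega) (hPup i (by omega))
          have h2 := diag h hf (i + 1) (by omega) (fun a ha => hA a (by omega))
          have hne := h.ne h1
          have h3 : ν (A (i + 1) (i + 1) / P A i i) + ν (P A i i) = ν (A (i + 1) (i + 1)) := by
            rw [← h.mul, div_mul_cancel₀ _ hne]
          have h4 := hsub (range (i + 1)) ((range (i + 1)).image fun x => x + 1)
          have e1 : range (i + 1) ∩ ((range (i + 1)).image fun x => x + 1) =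
              (range i).image fun x => x + 1 := by
            ext x
            simp only [mem_inter, mem_range, mem_image]
            constructor
            · rintro ⟨h1, y, h2, rfl⟩; exact ⟨y, by omega, rfl⟩
            · rintro ⟨y, h2, rfl⟩; exact ⟨by omega, y, by omega, rfl⟩
          have e2 : range (i + 1) ∪ ((range (i + 1)).image fun x => x + 1) = range (i + 1 + 1) := by
            ext x
            simp only [mem_union, mem_range, mem_image]
            constructor
            · rintro (h1 | ⟨y, h2, rfl⟩) <;> omega
            · intro hx
              by_cases h1 : x < i + 1
              · exact Or.inl h1
              · exact Or.inr ⟨x - 1, by omega, by omega⟩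
          rw [e1, e2] at h4
          rw [h1, h2] at h3
          generalize ν (A (i + 1) (i + 1) / P A i i) = z at h3 ⊢
          cases z with
          | bot => exact bot_le
          | coe z =>
            simp only [f'] at h3
            norm_cast at h3 ⊢
            linarith
      have hrow : ∀ i j, A i (j + 1) = c i * P A (i - 1) j + P A i j := by
        intro i j
        cases i with
        | zero => simp [c, P]
        | succ i => simp [c, P]
      have e : (Matrix.of fun i j : Fin k => A (t i) (s j)) = Matrix.of fun i j =>
          c (t i) * P A (t i - 1) (s j - 1) + P A (t i) (s j - 1) := by
        congr 1
        funext i j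
        rw [← hrow, hs0]
      have hs' : Function.Injective fun j => s j - 1 := by
        intro a b hab
        apply hs
        rw [← hs0 a, ← hs0 b]
        simp only at hab
        rw [hab]
      have hsn' : ∀ j, s j - 1 < n := fun j => by
        have := hs0 j
        have := hsn j
        omega
      have e2 : f' (univ.image fun j => s j - 1) = f (univ.image s) := by
        simp only [f', Finset.image_image, Function.comp_def, hs0]
      rw [e]
      refine h.expand (fun i j => P A (t i) (s j - 1)) (fun i j => P A (t i - 1) (s j - 1))
        (fun i => c (t i)) (fun i => hc _ (htn i)) _ fun S => ?_
      let t' : Fin k → ℕ := fun i => if i ∈ S then t i - 1 else t i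
      have e3 : (S.piecewise (fun i j => P A (t i - 1) (s j - 1)) (fun i j => P A (t i) (s j - 1)))
          = fun i j : Fin k => P A (t' i) (s j - 1) := by
        funext i j
        by_cases hi : i ∈ S <;> simp [hi, t']
      rw [e3]
      by_cases hall : ∀ i, t' i < n
      · rw [← e2]
        exact key k t' _ hs' hsn' hall
      · push Not at hall
        obtain ⟨i, hi⟩ := hall
        have hi2 : t' i = n := by
          have := htn i
          simp only [t'] at hi ⊢
          split_ifs at hi ⊢ <;> omega
        have : Matrix.det (Matrix.of fun i j : Fin k => P A (t' i) (s j - 1)) = 0 := by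
          refine Matrix.det_eq_zero_of_row_eq_zero i fun j => ?_
          rw [Matrix.of_apply, hi2]
          exact hPup n le_rfl n (by omega) _ (hsn' j)
        rw [this, h.zero]
        exact bot_le

theorem reorder (h : VL ν) {n k : ℕ} (B : Matrix (Fin n) (Fin n) K) (T S : Finset (Fin n))
    (hT : T.card = k) (hS : S.card = k) (s : Fin k → Fin n) (hs : Function.Injective s)
    (him : univ.image s = S) :
    ν (subDet B T S) = ν (Matrix.det (Matrix.of fun i j : Fin k => B (T.orderEmbOfFin hT i) (s j))) := by
  subst hS
  have hmem : ∀ j, s j ∈ S := fun j => him ▸ mem_image_of_mem s (mem_univ j)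
  let g : Fin S.card → Fin S.card := fun j => (S.orderIsoOfFin rfl).symm ⟨s j, hmem j⟩
  have hg : ∀ j, S.orderEmbOfFin rfl (g j) = s j := fun j => by
    simp [g, ← Finset.coe_orderIsoOfFin_apply]
  have hginj : Function.Injective g := fun a b hab => hs (by rw [← hg a, ← hg b, hab])
  let σ : Equiv.Perm (Fin S.card) := Equiv.ofBijective g (Finite.injective_iff_bijective.1 hginj)
  rw [subDet, dif_pos hT]
  have := Matrix.det_permute' σ (Matrix.of fun i j : Fin S.card =>
      B (T.orderEmbOfFin hT i) (S.orderEmbOfFin rfl j))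
  have e : (Matrix.of fun i j : Fin S.card =>
      B (T.orderEmbOfFin hT i) (S.orderEmbOfFin rfl j)).submatrix id σ =
      Matrix.of fun i j => B (T.orderEmbOfFin hT i) (s j) := by
    ext i j
    simp only [Matrix.submatrix_apply, Matrix.of_apply, id]
    rw [← hg j]
    rfl
  rw [e] at this
  rw [this, h.sgn]

theorem firstK_card {n k : ℕ} (hk : k ≤ n) : (firstK n k).card = k := by
  have : firstK n k = univ.image (Fin.castLE hk) := by
    ext x
    simp only [firstK, mem_filter, mem_univ, true_and, mem_image]
    exact ⟨fun hx => ⟨⟨x, hx⟩, rfl⟩, fun ⟨y, hy⟩ => hy ▸ y.2⟩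
  rw [this, Finset.card_image_of_injective _ (Fin.castLE_injective hk)]
  simp

theorem firstK_emb {n k : ℕ} (hk : k ≤ n) (h : (firstK n k).card = k) (i : Fin k) :
    (firstK n k).orderEmbOfFin h i = Fin.castLE hk i := by
  have := Finset.orderEmbOfFin_unique h (f := Fin.castLE hk) (fun x => by simp [firstK])
    (Fin.strictMono_castLE hk)
  rw [this]

end VL

theorem top_heavy_of_submodular
    {K : Type*} [Field K] (ν : K → WithBot ℝ)
    (hν0 : ∀ x : K, ν x = ⊥ ↔ x = 0)
    (hνmul : ∀ a b : K, ν (a * b) = ν a + ν b)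
    (hνadd : ∀ a b : K, ν (a + b) ≤ max (ν a) (ν b))
    {n : ℕ} (B : Matrix (Fin n) (Fin n) K)
    (hupper : ∀ i j : Fin n, j < i → B i j = 0)
    (hnz : ∀ S : Finset (Fin n), subDet B (firstK n S.card) S ≠ 0)
    (hsubmod : ∀ S T : Finset (Fin n),
      ν (subDet B (firstK n (S ∩ T).card) (S ∩ T)) +
          ν (subDet B (firstK n (S ∪ T).card) (S ∪ T)) ≤
        ν (subDet B (firstK n S.card) S) + ν (subDet B (firstK n T.card) T)) :
    ∀ S T : Finset (Fin n), T.card = S.card →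
      ν (subDet B T S) ≤ ν (subDet B (firstK n S.card) S) := by
  have h : VL ν := ⟨hν0, hνmul, hνadd⟩
  choose F hF using fun S => h.ex (hnz S)
  simp only [hF] at hsubmod ⊢
  norm_cast at hsubmod
  let A : ℕ → ℕ → K := fun i j => if hij : i < n ∧ j < n then B ⟨i, hij.1⟩ ⟨j, hij.2⟩ else 0
  have hAB : ∀ i j : Fin n, A i j = B i j := fun i j => by simp [A]
  let f : Finset ℕ → ℝ := fun S => F (univ.filter fun i : Fin n => (i : ℕ) ∈ S)
  have hfim : ∀ (k : ℕ) (s : Fin k → Fin n),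
      f (univ.image fun i => (s i : ℕ)) = F (univ.image s) := by
    intro k s
    simp only [f]
    congr 1
    ext x
    simp [Fin.ext_iff]
  have hup : ∀ i < n, ∀ j < i, A i j = 0 := by
    intro i hi j hj
    have := hAB ⟨i, hi⟩ ⟨j, hj.trans hi⟩
    simp only at this
    rw [this]
    exact hupper _ _ hj
  have hf : VL.HF ν n A f := by
    intro k s hs hsn
    obtain ⟨s, rfl⟩ : ∃ s' : Fin k → Fin n, s = fun i => (s' i : ℕ) :=
      ⟨fun i => ⟨s i, hsn i⟩, rfl⟩
    have hs' : Function.Injective s := fun a b hab => hs (by simp [hab])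
    have hk : k ≤ n := by simpa using Fintype.card_le_of_injective s hs'
    have hcard : (univ.image s).card = k := by
      rw [Finset.card_image_of_injective _ hs']; simp
    rw [hfim, ← hF, hcard,
      h.reorder B (firstK n k) (univ.image s) (VL.firstK_card hk) hcard s hs' rfl]
    congr 2
    ext i j
    simp only [Matrix.of_apply]
    rw [VL.firstK_emb hk, ← hAB]
    rfl
  have hsub : ∀ S T, f (S ∩ T) + f (S ∪ T) ≤ f S + f T := by
    intro S T
    have := hsubmod (univ.filter fun i : Fin n => (i : ℕ) ∈ S)
      (univ.filter fun i : Fin n => (i : ℕ) ∈ T)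
    rw [← Finset.filter_and, ← Finset.filter_or] at this
    simpa only [f, mem_inter, mem_union] using this
  intro S T hTS
  have him : univ.image (S.orderEmbOfFin rfl) = S := by
    apply Finset.coe_injective
    simp
  have := VL.main h n A f hup hf hsub S.card (fun i => (T.orderEmbOfFin hTS i : ℕ))
    (fun i => (S.orderEmbOfFin rfl i : ℕ))
    (Fin.val_injective.comp (S.orderEmbOfFin rfl).injective) (fun i => Fin.is_lt _)
    (fun i => Fin.is_lt _)
  rw [hfim, him] at this
  simp only [hAB] at this
  rw [subDet, dif_pos hTS]
  exact this
end

section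
/- Under the hypotheses (i)–(v) on w and submodularity of F(S) = w({1,...,|S|}, S), we have w({j},{k}) ≥ w({j+1},{k}) for all 1 ≤ j ≤ n-1 and 1 ≤ k ≤ n. -/
open Finset

/-- The maximum of the three quantities is attained by at least two of them. -/
def MaxTwiceW (x y z : WithBot ℝ) : Prop :=
  (x = y ∧ z ≤ x) ∨ (x = z ∧ y ≤ x) ∨ (y = z ∧ x ≤ y)

/-- `T ⪯ S`: the sets have the same size and, for each `j`, the `j`-th smallest
element of `T` is at most the `j`-th smallest element of `S`. -/
def PrecEq (T S : Finset ℕ) : Prop :=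
  ∃ h : T.card = S.card, ∀ j : Fin S.card,
    T.orderEmbOfFin h j ≤ S.orderEmbOfFin rfl j

/-- A nonempty set of consecutive integers. -/
def IsIntervalN (I : Finset ℕ) : Prop :=
  I.Nonempty ∧ ∀ a ∈ I, ∀ b ∈ I, ∀ c : ℕ, a ≤ c → c ≤ b → c ∈ I

/-- Hypotheses (i)-(v) on `w`, together with submodularity of
`F(S) = w({1,...,|S|}, S)`, on the ground set `{1, ..., n}`. -/
structure WHyp (n : ℕ) (w : Finset ℕ → Finset ℕ → WithBot ℝ) : Prop where
  /-- (i) top-justified values are finite -/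
  h1 : ∀ S ⊆ Icc 1 n, w (Icc 1 S.card) S ≠ ⊥
  /-- (ii) `w(T,S) = -∞` when `T ⪯ S` fails -/
  h2 : ∀ T ⊆ Icc 1 n, ∀ S ⊆ Icc 1 n, T.card = S.card → ¬ PrecEq T S → w T S = ⊥
  /-- (iii) splitting off an initial interval -/
  h3 : ∀ I ⊆ Icc 1 n, IsIntervalN I → ∀ T ⊆ Icc 1 n, ∀ S ⊆ Icc 1 n,
      T.card = S.card → (∀ i ∈ I, ∀ x ∈ T ∪ S, i < x) →
      w (I ∪ T) (I ∪ S) = (∑ i ∈ I, w {i} {i}) + w T S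
  /-- (iv) splitting off a final element -/
  h4 : ∀ T ⊆ Icc 1 n, ∀ S ⊆ Icc 1 n, T.card = S.card →
      ∀ t ∈ Icc 1 n, ∀ s ∈ Icc 1 n, t ∉ T → s ∉ S →
      (∀ x ∈ T ∪ S, x ≤ t) → (∀ x ∈ T ∪ S, x ≤ s) →
      w (insert t T) (insert s S) = w T S + w {t} {s}
  /-- (v) three-term tropical Plücker relations in the rows -/
  h5 : ∀ S ⊆ Icc 1 n, 2 ≤ S.card → ∀ R ⊆ Icc 1 n, R.card = S.card - 2 →
      ∀ a ∈ Icc 1 n, ∀ b ∈ Icc 1 n, ∀ c ∈ Icc 1 n, ∀ d ∈ Icc 1 n,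
      a < b → b < c → c < d → a ∉ R → b ∉ R → c ∉ R → d ∉ R →
      MaxTwiceW (w (R ∪ {a, b}) S + w (R ∪ {c, d}) S)
                (w (R ∪ {a, c}) S + w (R ∪ {b, d}) S)
                (w (R ∪ {a, d}) S + w (R ∪ {b, c}) S)
  /-- submodularity of `F(S) = w({1,...,|S|}, S)` -/
  hsub : ∀ S ⊆ Icc 1 n, ∀ T ⊆ Icc 1 n,
      w (Icc 1 (S ∩ T).card) (S ∩ T) + w (Icc 1 (S ∪ T).card) (S ∪ T) ≤
        w (Icc 1 S.card) S + w (Icc 1 T.card) T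

theorem singleton_row_monotone
    (n : ℕ) (w : Finset ℕ → Finset ℕ → WithBot ℝ) (hw : WHyp n w) :
    ∀ j k : ℕ, 1 ≤ j → j + 1 ≤ n → 1 ≤ k → k ≤ n →
      w {j + 1} {k} ≤ w {j} {k} := by
  intro j k hj hjn hk hkn
  by_cases hkj : k ≤ j
  · have : w {j + 1} {k} = ⊥ := by
      apply hw.h2
      · intro x; simp; omega
      · intro x; simp; omega
      · simp
      · rintro ⟨h, h'⟩
        have h0 := h' ⟨0, by simp⟩
        have e1 := Finset.orderEmbOfFin_mem {j + 1} h ⟨0, by simp⟩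
        have e2 := Finset.orderEmbOfFin_mem {k} rfl ⟨0, by simp⟩
        rw [Finset.mem_singleton] at e1 e2
        rw [e1, e2] at h0
        omega
    rw [this]; exact bot_le
  push Not at hkj
  obtain ⟨m, rfl⟩ : ∃ m, j = m + 1 := ⟨j - 1, by omega⟩
  have sub : ∀ i, i ≤ n → Icc 1 i ⊆ Icc 1 n := fun i hi => Finset.Icc_subset_Icc le_rfl hi
  have step : ∀ i, i + 1 ≤ k → w (Icc 1 (i + 1)) (insert k (Icc 1 i)) =
      w (Icc 1 i) (Icc 1 i) + w {i + 1} {k} := by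
    intro i hi
    have h := hw.h4 (Icc 1 i) (sub i (by omega)) (Icc 1 i) (sub i (by omega)) rfl (i + 1)
      (by simp; omega) k (by simp; omega) (by simp) (by simp; omega)
      (by intro x; simp; omega) (by intro x; simp; omega)
    rw [← h]
    congr 1
    ext x; simp; omega
  have hA := hw.h1 (Icc 1 m) (sub m (by omega))
  have hB := hw.h1 (Icc 1 (m + 1)) (sub (m + 1) (by omega))
  have hT : insert k (Icc 1 m) ⊆ Icc 1 n := by intro x; simp; omega
  have hs := hw.hsub (Icc 1 (m + 1)) (sub (m + 1) (by omega)) (insert k (Icc 1 m)) hT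
  have e1 : Icc 1 (m + 1) ∩ insert k (Icc 1 m) = Icc 1 m := by ext x; simp; omega
  have e2 : Icc 1 (m + 1) ∪ insert k (Icc 1 m) = insert k (Icc 1 (m + 1)) := by
    ext x; simp; omega
  have c : ∀ i, i + 1 ≤ k → (insert k (Icc 1 i)).card = i + 1 := by
    intro i hi
    rw [Finset.card_insert_of_notMem (by simp; omega)]; simp
  rw [e1, e2, c m (by omega), c (m + 1) (by omega), step m (by omega),
    step (m + 1) (by omega)] at hs
  simp only [Nat.card_Icc, Nat.add_sub_cancel] at hs hA hB
  generalize w (Icc 1 m) (Icc 1 m) = A at *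
  generalize w (Icc 1 (m + 1)) (Icc 1 (m + 1)) = B at *
  rw [← add_assoc, ← add_assoc, add_comm B A] at hs
  lift A to ℝ using hA
  lift B to ℝ using hB
  rw [← WithBot.coe_add] at hs
  exact (WithBot.add_le_add_iff_left WithBot.coe_ne_bot).1 hs
end

section
/- Under the hypotheses (i)–(v) on w and submodularity of F(S) = w({1,...,|S|}, S), the following holds. Let I ⊆ [n] be an interval with max(I) < n and let S ⊆ [n] satisfy |I| = |S| and I ⪯ S, and write 1+I = {i+1 : i ∈ I}. Then w(I,S) + w((1+I)∖{max(I)+1}, S∖{max(S)}) ≥ w(1+I, S) + w(I∖{max(I)}, S∖{max(S)}), and moreover w(I∖{max(I)}, S∖{max(S)}) ≥ w((1+I)∖{max(I)+1}, S∖{max(S)}). -/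
open Finset

theorem prec_lb {T S : Finset ℕ} (h : PrecEq T S) (c : ℕ) (hT : ∀ t ∈ T, c ≤ t) :
    ∀ s ∈ S, c ≤ s := by
  obtain ⟨hc, hj⟩ := h
  intro s hs
  have : s ∈ Set.range (S.orderEmbOfFin rfl) := by
    rw [Finset.range_orderEmbOfFin]; exact hs
  obtain ⟨j, rfl⟩ := this
  exact (hT _ (Finset.orderEmbOfFin_mem T hc j)).trans (hj j)

theorem interval_Icc {p q : ℕ} (h : p ≤ q) : IsIntervalN (Icc p q) := by
  refine ⟨⟨p, by simp [h]⟩, ?_⟩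
  intro a ha b hb c h1 h2
  simp only [mem_Icc] at *
  omega

theorem card_top {a : ℕ} {S : Finset ℕ} (hS : ∀ x ∈ S, a < x) :
    (Icc 1 a ∪ S).card = a + S.card := by
  rw [card_union_of_disjoint]
  · simp
  · rw [disjoint_left]
    intro x hx hx'
    have := hS x hx'
    simp only [mem_Icc] at hx
    omega

theorem key {n : ℕ} {w : Finset ℕ → Finset ℕ → WithBot ℝ} (hw : WHyp n w) (a : ℕ) (ha : a ≤ n)
    (S : Finset ℕ) (hS : S ⊆ Icc 1 n) (hSa : ∀ x ∈ S, a < x) :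
    w (Icc 1 (Icc 1 a ∪ S).card) (Icc 1 a ∪ S) =
      (∑ i ∈ Icc 1 a, w {i} {i}) + w (Icc (a+1) (a + S.card)) S := by
  rw [card_top hSa]
  rcases Nat.eq_zero_or_pos a with rfl | hpos
  · simp
  have hsub : S ⊆ Icc (a+1) n := by
    intro x hx
    have h1 := hSa x hx
    have h2 := hS hx
    simp only [mem_Icc] at *
    omega
  have hcard : S.card ≤ n - a := by
    have := card_le_card hsub
    simp at this
    omega
  have hI : Icc 1 a ⊆ Icc 1 n := Icc_subset_Icc le_rfl ha
  have hT : Icc (a+1) (a + S.card) ⊆ Icc 1 n := Icc_subset_Icc (by omega) (by omega)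
  have := hw.h3 (Icc 1 a) hI (interval_Icc hpos) (Icc (a+1) (a + S.card)) hT S hS (by simp) ?_
  · rw [← this]
    congr 1
    ext x
    simp only [mem_union, mem_Icc]
    omega
  · intro i hi x hx
    rw [mem_union] at hx
    simp only [mem_Icc] at hi hx
    rcases hx with hx | hx
    · omega
    · have := hSa x hx
      omega

theorem diag_ne {n : ℕ} {w : Finset ℕ → Finset ℕ → WithBot ℝ} (hw : WHyp n w) (a : ℕ) (ha : a ≤ n) :
    (∑ i ∈ Icc 1 a, w {i} {i}) ≠ ⊥ := by
  have h := key hw a ha ∅ (by simp) (by simp)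
  have h' := hw.h1 (Icc 1 a ∪ ∅) (by simpa using Icc_subset_Icc le_rfl ha)
  intro h0
  rw [h0] at h
  simp at h h'
  exact h' h

theorem shift_bot {n : ℕ} {w : Finset ℕ → Finset ℕ → WithBot ℝ} (hw : WHyp n w) (p : ℕ)
    (S : Finset ℕ) (hS : S ⊆ Icc 1 n) (hp : p + 1 + S.card ≤ n) (hm : p + 1 ∈ S) :
    w (Icc (p+1+1) (p+1+S.card)) S = ⊥ := by
  apply hw.h2 _ (Icc_subset_Icc (by omega) hp) S hS (by simp)
  intro h
  have := prec_lb h (p+1+1) (by intro t ht; simp only [mem_Icc] at ht; omega) _ hm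
  omega

/-- General submodular comparison for `S' ⊆ S`. -/
theorem shift_cmp {n : ℕ} {w : Finset ℕ → Finset ℕ → WithBot ℝ} (hw : WHyp n w) (p : ℕ)
    (S S' : Finset ℕ) (hS : S ⊆ Icc 1 n) (hp : p + 1 ≤ n) (hSS : S' ⊆ S)
    (hSp : ∀ x ∈ S, p + 1 < x) :
    w (Icc (p+1+1) (p+1+S.card)) S + w (Icc (p+1) (p+S'.card)) S' ≤
      w (Icc (p+1) (p+S.card)) S + w (Icc (p+1+1) (p+1+S'.card)) S' := by
  have hs := hw.hsub (Icc 1 p ∪ S) (union_subset (Icc_subset_Icc le_rfl (by omega)) hS)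
    (Icc 1 (p+1) ∪ S') (union_subset (Icc_subset_Icc le_rfl hp) (hSS.trans hS))
  have e1 : (Icc 1 p ∪ S) ∩ (Icc 1 (p+1) ∪ S') = Icc 1 p ∪ S' := by
    ext x
    have h1 := hSp x
    have h2 : x ∈ S' → x ∈ S := fun h => hSS h
    simp only [mem_inter, mem_union, mem_Icc]
    grind
  have e2 : (Icc 1 p ∪ S) ∪ (Icc 1 (p+1) ∪ S') = Icc 1 (p+1) ∪ S := by
    ext x
    have h2 : x ∈ S' → x ∈ S := fun h => hSS h
    simp only [mem_union, mem_Icc]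
    grind
  rw [e1, e2, key hw p (by omega) S' (hSS.trans hS) (fun x hx => by have := hSp x (hSS hx); omega),
    key hw (p+1) hp S hS hSp, key hw p (by omega) S hS (fun x hx => by have := hSp x hx; omega),
    key hw (p+1) hp S' (hSS.trans hS) (fun x hx => hSp x (hSS hx))] at hs
  have d1 := diag_ne hw p (by omega)
  have d2 := diag_ne hw (p+1) hp
  generalize (∑ i ∈ Icc 1 p, w {i} {i}) = D1 at *
  generalize (∑ i ∈ Icc 1 (p+1), w {i} {i}) = D2 at *
  have hd : D1 + D2 ≠ ⊥ := by
    simp [WithBot.add_eq_bot, d1, d2]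
  refine (WithBot.add_le_add_iff_left hd).1 ?_
  rw [add_comm (w (Icc (p+1+1) (p+1+S.card)) S), add_add_add_comm D1 D2,
    add_add_add_comm D1 D2]
  exact hs

theorem shift_mono {n : ℕ} {w : Finset ℕ → Finset ℕ → WithBot ℝ} (hw : WHyp n w) (p : ℕ)
    (S : Finset ℕ) (hS : S ⊆ Icc 1 n) (hp : p + 1 + S.card ≤ n)
    (hSp : ∀ x ∈ S, p + 1 ≤ x) :
    w (Icc (p+1+1) (p+1+S.card)) S ≤ w (Icc (p+1) (p+S.card)) S := by
  by_cases hm : p + 1 ∈ S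
  · rw [shift_bot hw p S hS hp hm]; exact bot_le
  have h := shift_cmp hw p S ∅ hS (by omega) (by simp) (fun x hx =>
    lt_of_le_of_ne (hSp x hx) (fun h => hm (h ▸ hx)))
  have h0 : w ∅ ∅ ≠ ⊥ := by simpa using hw.h1 ∅ (by simp)
  simp only [card_empty, add_zero, Icc_eq_empty_of_lt (Nat.lt_succ_self _)] at h
  exact (WithBot.add_le_add_iff_right h0).1 h

theorem interval_shift_inequality
    (n : ℕ) (w : Finset ℕ → Finset ℕ → WithBot ℝ) (hw : WHyp n w) :
    ∀ I ⊆ Icc 1 n, IsIntervalN I → ∀ S ⊆ Icc 1 n, I.card = S.card → PrecEq I S →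
    ∀ mI ∈ I, (∀ i ∈ I, i ≤ mI) → mI < n →
    ∀ mS ∈ S, (∀ s ∈ S, s ≤ mS) →
      (w (I.image (· + 1)) S + w (I.erase mI) (S.erase mS) ≤
        w I S + w ((I.image (· + 1)).erase (mI + 1)) (S.erase mS)) ∧
      w ((I.image (· + 1)).erase (mI + 1)) (S.erase mS) ≤
        w (I.erase mI) (S.erase mS) := by
  intro I hI hint S hS hcard hprec mI hmI hmax hlt mS hmS hmaxS
  obtain ⟨p, hp⟩ : ∃ p, I = Icc (p+1) mI := by
    obtain ⟨q, hq⟩ : ∃ q, q = I.min' hint.1 := ⟨_, rfl⟩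
    have hqI : q ∈ I := hq ▸ I.min'_mem _
    have hq1 := hI hqI
    rw [mem_Icc] at hq1
    refine ⟨q - 1, ?_⟩
    ext x
    rw [mem_Icc]
    constructor
    · intro hx
      have h1 : q ≤ x := hq ▸ I.min'_le _ hx
      exact ⟨by omega, hmax x hx⟩
    · rintro ⟨h1, h2⟩
      exact hint.2 q hqI mI hmI x (by omega) h2
  have hpm : p + 1 ≤ mI := by
    rw [hp, mem_Icc] at hmI; exact hmI.1
  have hk : mI = p + S.card := by
    rw [hp] at hcard; simp at hcard; omega
  have hk1 : (S.erase mS).card + 1 = S.card := card_erase_add_one hmS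
  have hSp : ∀ x ∈ S, p + 1 ≤ x := prec_lb hprec (p+1) (by
    intro t ht; rw [hp, mem_Icc] at ht; exact ht.1)
  have e1 : I = Icc (p+1) (p+S.card) := by rw [hp, hk]
  have e2 : I.image (· + 1) = Icc (p+1+1) (p+1+S.card) := by
    ext x
    rw [e1]
    simp only [mem_image, mem_Icc]
    constructor
    · rintro ⟨y, h, rfl⟩; omega
    · intro h; exact ⟨x - 1, by omega, by omega⟩
  have e3 : I.erase mI = Icc (p+1) (p+(S.erase mS).card) := by
    ext x
    rw [e1]
    simp only [mem_erase, mem_Icc]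
    omega
  have e4 : (I.image (· + 1)).erase (mI + 1) = Icc (p+1+1) (p+1+(S.erase mS).card) := by
    ext x
    rw [e2]
    simp only [mem_erase, mem_Icc]
    omega
  rw [e4, e2, e3, e1]
  have hS' : S.erase mS ⊆ S := erase_subset _ _
  refine ⟨?_, shift_mono hw p _ (hS'.trans hS) (by omega) (fun x hx => hSp x (hS' hx))⟩
  by_cases hm : p + 1 ∈ S
  · rw [shift_bot hw p S hS (by omega) hm, WithBot.bot_add]; exact bot_le
  · exact shift_cmp hw p S _ hS (by omega) hS' (fun x hx =>
      lt_of_le_of_ne (hSp x hx) (fun h => hm (h ▸ hx)))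
end

section
/- Let K be a field with a valuation-like map ν, let B be an n×n matrix over K, and let S ⊆ [n] with |S| = k ≥ 2. Then for every R ⊆ [n] with |R| = k-2 and all distinct a < b < c < d in [n]∖R, the maximum of the three quantities ν(det B(R∪{a,b},S)) + ν(det B(R∪{c,d},S)), ν(det B(R∪{a,c},S)) + ν(det B(R∪{b,d},S)), ν(det B(R∪{a,d},S)) + ν(det B(R∪{b,c},S)) is attained by at least two of them (values taken in ℝ∪{-∞}, where x+(-∞) = -∞). -/
open Finset

theorem plk_aux {K ι : Type*} [CommRing K] [Fintype ι] [DecidableEq ι] (M : Matrix ι ι K)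
    (i0 i1 : ι) (h01 : i0 ≠ i1) (D : (ι → K) → (ι → K) → K)
    (hD : ∀ x y, D x y = ((M.updateRow i0 x).updateRow i1 y).det) (a b c d : ι → K) :
    D a b * D c d = D a c * D b d + D c b * D a d := by
  have hlin : ∀ (s : Finset ι) (w : ι → K) (v : ι → ι → K),
      D (∑ i ∈ s, w i • v i) d = ∑ i ∈ s, w i * D (v i) d := by
    intro s w v
    have key : ∀ x, D x d =
        (Matrix.detRowAlternating (R := K)).toMultilinearMap.toLinearMap (M.updateRow i1 d) i0 x := by
      intro x
      rw [hD, Matrix.updateRow_comm _ h01]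
      rfl
    simp only [key, map_sum, map_smul, smul_eq_mul]
  have hsm : ∀ (w : K) (v : ι → K), D (w • v) d = w * D v d := by
    intro w v
    have := hlin {i0} (fun _ => w) (fun _ => v)
    simpa using this
  set A := (M.updateRow i0 a).updateRow i1 b with hA
  have hc : D a b • c = ∑ i, (A.updateRow i c).det • A i := by
    rw [hD, ← hA, ← Matrix.det_transpose, ← Matrix.mulVec_cramer]
    ext j
    simp [Matrix.mulVec, dotProduct, Matrix.cramer_transpose_apply, Finset.sum_apply, mul_comm]
  rw [← hsm, hc]
  refine (hlin Finset.univ (fun i => (A.updateRow i c).det) (fun i => A i)).trans ?_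
  have hA0 : A i0 = a := by
    rw [hA, Matrix.updateRow_ne h01, Matrix.updateRow_self]
  have hA1 : A i1 = b := by
    rw [hA, Matrix.updateRow_self]
  rw [← Finset.sum_subset (Finset.subset_univ {i1, i0}), Finset.sum_pair h01.symm, hA0, hA1]
  · congr 2
    · rw [hD, hA, Matrix.updateRow_idem]
    · rw [hD, hA, Matrix.updateRow_comm _ h01.symm, Matrix.updateRow_idem,
        Matrix.updateRow_comm _ h01]
  · intro i _ hi
    simp only [Finset.mem_insert, Finset.mem_singleton, not_or] at hi
    refine mul_eq_zero_of_right _ ?_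
    rw [hD]
    refine Matrix.det_zero_of_row_eq hi.2 ?_
    rw [Matrix.updateRow_ne hi.1, Matrix.updateRow_ne hi.2, Matrix.updateRow_ne h01,
      Matrix.updateRow_self, hA, Matrix.updateRow_ne hi.1, Matrix.updateRow_ne hi.2]

theorem subDet_aux {K : Type*} [CommRing K] {n : ℕ}
    (B : Matrix (Fin n) (Fin n) K) (T S : Finset (Fin n)) (h : T.card = S.card)
    (f : Fin S.card → Fin n) (hf : Finset.univ.image f = T) :
    subDet B T S = (Matrix.of fun i j => B (f i) (S.orderEmbOfFin rfl j)).det ∨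
    subDet B T S = -(Matrix.of fun i j => B (f i) (S.orderEmbOfFin rfl j)).det := by
  have hinj : Function.Injective f := by
    have : Set.InjOn f (Finset.univ : Finset (Fin S.card)) := by
      rw [← Finset.card_image_iff, hf, h]; simp
    simpa [Set.injOn_univ] using this
  have hmem : ∀ i, ∃ j, T.orderEmbOfFin h j = f i := by
    intro i
    have : f i ∈ Set.range (T.orderEmbOfFin h) := by
      rw [Finset.range_orderEmbOfFin, ← hf]; simp
    exact this
  choose σ hσ using hmem
  have hσi : Function.Injective σ := by
    intro i j hij
    apply hinj
    rw [← hσ, ← hσ, hij]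
  let e : Equiv.Perm (Fin S.card) := Equiv.ofBijective σ (Finite.injective_iff_bijective.mp hσi)
  have := Matrix.det_permute e
    (Matrix.of fun i j : Fin S.card => B (T.orderEmbOfFin h i) (S.orderEmbOfFin rfl j))
  have h2 : (Matrix.of fun i j => B (f i) (S.orderEmbOfFin rfl j)) =
      (Matrix.of fun i j : Fin S.card =>
        B (T.orderEmbOfFin h i) (S.orderEmbOfFin rfl j)).submatrix e id := by
    ext i j
    simp [e, hσ]
  rw [h2, this, subDet, dif_pos h]
  rcases Int.units_eq_one_or (Equiv.Perm.sign e) with h | h <;> simp [h]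

theorem tropical_pluecker_for_minors
    {K : Type*} [Field K] (ν : K → WithBot ℝ)
    (hν0 : ∀ x : K, ν x = ⊥ ↔ x = 0)
    (hνmul : ∀ a b : K, ν (a * b) = ν a + ν b)
    (hνadd : ∀ a b : K, ν (a + b) ≤ max (ν a) (ν b))
    {n : ℕ} (B : Matrix (Fin n) (Fin n) K)
    (S : Finset (Fin n)) (hS : 2 ≤ S.card)
    (R : Finset (Fin n)) (hR : R.card = S.card - 2)
    (a b c d : Fin n) (hab : a < b) (hbc : b < c) (hcd : c < d)
    (haR : a ∉ R) (hbR : b ∉ R) (hcR : c ∉ R) (hdR : d ∉ R) :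
    MaxTwiceW (ν (subDet B (R ∪ {a, b}) S) + ν (subDet B (R ∪ {c, d}) S))
              (ν (subDet B (R ∪ {a, c}) S) + ν (subDet B (R ∪ {b, d}) S))
              (ν (subDet B (R ∪ {a, d}) S) + ν (subDet B (R ∪ {b, c}) S)) := by
  have hneg : ∀ x, ν (-x) = ν x := by
    intro x
    have h : ν (-x) + ν (-x) = ν x + ν x := by
      rw [← hνmul, ← hνmul, neg_mul_neg]
    generalize ν (-x) = u at h
    generalize ν x = v at h
    induction u <;> induction v
    · rfl
    · simp [← WithBot.coe_add] at h
    · simp [← WithBot.coe_add] at h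
    · rw [← WithBot.coe_add, ← WithBot.coe_add, WithBot.coe_inj] at h
      rw [WithBot.coe_inj]; linarith
  have hcard : ∀ x y, x ∉ R → y ∉ R → x ≠ y → (R ∪ {x, y}).card = S.card := by
    intro x y hx hy hxy
    rw [Finset.card_union_of_disjoint, Finset.card_pair hxy]
    · omega
    · simp [hx, hy]
  have hT := hcard a b haR hbR hab.ne
  set g := (R ∪ {a, b}).orderEmbOfFin hT with hg
  have hr : ∀ x, x ∈ R ∪ {a, b} ↔ ∃ i, g i = x := by
    intro x
    have := Finset.range_orderEmbOfFin (R ∪ {a, b}) hT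
    rw [← Finset.mem_coe, ← this]; rfl
  obtain ⟨i0, h0⟩ := (hr a).1 (by simp)
  obtain ⟨i1, h1⟩ := (hr b).1 (by simp)
  have h01 : i0 ≠ i1 := by rintro rfl; exact hab.ne (h0.symm.trans h1)
  let rw' : Fin n → Fin S.card → K := fun x j => B x (S.orderEmbOfFin rfl j)
  let M : Matrix (Fin S.card) (Fin S.card) K := Matrix.of fun i => rw' (g i)
  have hD : ∀ x y, x ∉ R → y ∉ R → x ≠ y → ν (subDet B (R ∪ {x, y}) S) =
      ν ((M.updateRow i0 (rw' x)).updateRow i1 (rw' y)).det := by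
    intro x y hx hy hxy
    have hf : Finset.univ.image (Function.update (Function.update g i0 x) i1 y) = R ∪ {x, y} := by
      ext z
      simp only [Finset.mem_image, Finset.mem_univ, true_and]
      constructor
      · rintro ⟨i, rfl⟩
        by_cases hi1 : i = i1
        · subst hi1; simp
        by_cases hi0 : i = i0
        · subst hi0; simp [hi1]
        rw [Function.update_of_ne hi1, Function.update_of_ne hi0]
        have hm := (hr (g i)).2 ⟨i, rfl⟩
        have e0 : g i ≠ a := fun h => hi0 (g.injective (h.trans h0.symm))
        have e1 : g i ≠ b := fun h => hi1 (g.injective (h.trans h1.symm))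
        simp only [Finset.mem_union, Finset.mem_insert, Finset.mem_singleton, e0, e1, or_false] at hm
        simp [hm]
      · intro hz
        simp only [Finset.mem_union, Finset.mem_insert, Finset.mem_singleton] at hz
        rcases hz with hz | rfl | rfl
        · obtain ⟨i, hi⟩ := (hr z).1 (by simp [hz])
          have e0 : i ≠ i0 := by rintro rfl; exact haR (h0 ▸ hi ▸ hz)
          have e1 : i ≠ i1 := by rintro rfl; exact hbR (h1 ▸ hi ▸ hz)
          exact ⟨i, by rw [Function.update_of_ne e1, Function.update_of_ne e0, hi]⟩
        · exact ⟨i0, by rw [Function.update_of_ne h01, Function.update_self]⟩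
        · exact ⟨i1, by rw [Function.update_self]⟩
    have hM : (Matrix.of fun i j =>
        B (Function.update (Function.update g i0 x) i1 y i) (S.orderEmbOfFin rfl j)) =
        (M.updateRow i0 (rw' x)).updateRow i1 (rw' y) := by
      ext i j
      by_cases hi1 : i = i1
      · subst hi1; simp [rw']
      by_cases hi0 : i = i0
      · subst hi0; simp [rw', hi1]
      simp [rw', M, hi1, hi0]
    have := subDet_aux B _ S (hcard x y hx hy hxy) _ hf
    rw [hM] at this
    rcases this with h | h <;> rw [h]
    rw [hneg]
  have hbc' : R ∪ {b, c} = R ∪ {c, b} := by rw [Finset.pair_comm]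
  rw [hbc', hD a b haR hbR hab.ne, hD c d hcR hdR hcd.ne, hD a c haR hcR (hab.trans hbc).ne,
    hD b d hbR hdR (hbc.trans hcd).ne, hD a d haR hdR (hab.trans (hbc.trans hcd)).ne,
    hD c b hcR hbR hbc.ne']
  have hP := plk_aux M i0 i1 h01 (fun x y => ((M.updateRow i0 x).updateRow i1 y).det)
    (fun _ _ => rfl) (rw' a) (rw' b) (rw' c) (rw' d)
  simp only [← hνmul]
  rw [add_comm] at hP
  simp only [mul_comm (((M.updateRow i0 (rw' c)).updateRow i1 (rw' b)).det)] at hP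
  generalize ((M.updateRow i0 (rw' a)).updateRow i1 (rw' b)).det *
    ((M.updateRow i0 (rw' c)).updateRow i1 (rw' d)).det = p at *
  generalize ((M.updateRow i0 (rw' a)).updateRow i1 (rw' c)).det *
    ((M.updateRow i0 (rw' b)).updateRow i1 (rw' d)).det = q at *
  generalize ((M.updateRow i0 (rw' a)).updateRow i1 (rw' d)).det *
    ((M.updateRow i0 (rw' c)).updateRow i1 (rw' b)).det = r at *
  have k1 : ν p ≤ max (ν r) (ν q) := hP ▸ hνadd r q
  have k2 : ν q ≤ max (ν p) (ν r) := by
    have := hνadd p (-r)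
    rwa [hneg, show p + -r = q by rw [hP]; ring] at this
  have k3 : ν r ≤ max (ν p) (ν q) := by
    have := hνadd p (-q)
    rwa [hneg, show p + -q = r by rw [hP]; ring] at this
  unfold MaxTwiceW
  rw [le_max_iff] at k1 k2 k3
  generalize ν p = x at *
  generalize ν q = y at *
  generalize ν r = z at *
  clear hP hD
  grind
end

section
/- Let c12, c13, c14, c23, c24, c34 be nonnegative real numbers and let Q be the 4×4 real symmetric matrix with zero diagonal and off-diagonal entries Q_{12} = c34, Q_{13} = c24, Q_{14} = c23, Q_{23} = c14, Q_{24} = c13, Q_{34} = c12. If Q has at most one positive eigenvalue (counted with multiplicity), then for every r ∈ ℝ: (r+1)·c14·c23 + r(r+1)·c13·c24 ≥ r·c12·c34. -/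
open Finset

lemma prod_nonpos_aux (a b c d : ℝ) (hs : a + b + c + d = 0)
    (h1 : ¬ (0 < a ∧ 0 < b)) (h2 : ¬ (0 < a ∧ 0 < c)) (h3 : ¬ (0 < a ∧ 0 < d))
    (h4 : ¬ (0 < b ∧ 0 < c)) (h5 : ¬ (0 < b ∧ 0 < d)) (h6 : ¬ (0 < c ∧ 0 < d)) :
    a * b * c * d ≤ 0 := by
  have key : ∀ x y z w : ℝ, 0 ≤ x → y ≤ 0 → z ≤ 0 → w ≤ 0 → x * (y * z * w) ≤ 0 := by
    intro x y z w hx hy hz hw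
    exact mul_nonpos_of_nonneg_of_nonpos hx
      (mul_nonpos_of_nonneg_of_nonpos (mul_nonneg_of_nonpos_of_nonpos hy hz) hw)
  have g : ∀ x y : ℝ, ¬ (0 < x ∧ 0 < y) → 0 < x → y ≤ 0 :=
    fun x y h hx => not_lt.1 fun hy => h ⟨hx, hy⟩
  have g' : ∀ x y : ℝ, ¬ (0 < x ∧ 0 < y) → 0 < y → x ≤ 0 :=
    fun x y h hy => not_lt.1 fun hx => h ⟨hx, hy⟩
  by_cases ha : 0 < a
  · linarith [key a b c d ha.le (g _ _ h1 ha) (g _ _ h2 ha) (g _ _ h3 ha)]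
  by_cases hb : 0 < b
  · linarith [key b a c d hb.le (g' _ _ h1 hb) (g _ _ h4 hb) (g _ _ h5 hb)]
  by_cases hc : 0 < c
  · linarith [key c a b d hc.le (g' _ _ h2 hc) (g' _ _ h4 hc) (g _ _ h6 hc)]
  have hd : 0 ≤ d := by linarith
  linarith [key d a b c hd (not_lt.1 ha) (not_lt.1 hb) (not_lt.1 hc)]

theorem quadratic_lorentzian_inequality
    (c12 c13 c14 c23 c24 c34 : ℝ)
    (h12 : 0 ≤ c12) (h13 : 0 ≤ c13) (h14 : 0 ≤ c14)
    (h23 : 0 ≤ c23) (h24 : 0 ≤ c24) (h34 : 0 ≤ c34)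
    (Q : Matrix (Fin 4) (Fin 4) ℝ)
    (hQdef : Q = !![0, c34, c24, c23;
                    c34, 0, c14, c13;
                    c24, c14, 0, c12;
                    c23, c13, c12, 0])
    (hQ : Q.IsHermitian)
    (heig : (Finset.univ.filter fun i => 0 < hQ.eigenvalues i).card ≤ 1) :
    ∀ r : ℝ, r * (c12 * c34) ≤ (r + 1) * (c14 * c23) + r * (r + 1) * (c13 * c24) := by
  have hp : ∀ i j, i ≠ j → ¬ (0 < hQ.eigenvalues i ∧ 0 < hQ.eigenvalues j) := by
    intro i j hij h
    exact hij (Finset.card_le_one.1 heig i (by simpa using h.1) j (by simpa using h.2))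
  have ht := hQ.trace_eq_sum_eigenvalues
  have hd := hQ.det_eq_prod_eigenvalues
  simp only [Fin.sum_univ_four, Fin.prod_univ_four, RCLike.ofReal_real_eq_id, id] at ht hd
  have ht0 : Q.trace = 0 := by
    rw [hQdef]; simp [Matrix.trace, Fin.sum_univ_four]
  have hdet : Q.det = (c13 * c24 + c14 * c23 - c12 * c34) ^ 2
      - 4 * (c13 * c24) * (c14 * c23) := by
    rw [hQdef]
    simp [Matrix.det_succ_row_zero, Fin.sum_univ_succ, Fin.succAbove]
    ring
  have hn := prod_nonpos_aux _ _ _ _ (ht.symm.trans ht0)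
    (hp 0 1 (by decide)) (hp 0 2 (by decide)) (hp 0 3 (by decide))
    (hp 1 2 (by decide)) (hp 1 3 (by decide)) (hp 2 3 (by decide))
  rw [← hd, hdet] at hn
  have hB : 0 ≤ c13 * c24 := mul_nonneg h13 h24
  have hC : 0 ≤ c14 * c23 := mul_nonneg h14 h23
  generalize c13 * c24 = B at *
  generalize c14 * c23 = C at *
  generalize c12 * c34 = A at *
  intro r
  rcases hB.eq_or_lt with h | h
  · subst h
    have : C - A = 0 := by
      apply pow_eq_zero_iff (two_ne_zero) |>.1
      nlinarith [sq_nonneg (C - A)]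
    have hA : A = C := by linarith
    subst hA
    linarith
  · have : 0 ≤ 4 * B * ((r + 1) * C + r * (r + 1) * B - r * A) := by
      nlinarith [sq_nonneg (2 * B * r + (B + C - A))]
    have := nonneg_of_mul_nonneg_right this (by positivity)
    linarith
end

section
/- Let A be an n×n real symmetric positive semidefinite matrix, let S ⊆ [n], and let a,b,c,d ∈ [n]∖S be pairwise distinct. Then for every r ∈ ℝ: (r+1)·A_{S∪{a,d}}·A_{S∪{b,c}} + r(r+1)·A_{S∪{a,c}}·A_{S∪{b,d}} ≥ r·A_{S∪{a,b}}·A_{S∪{c,d}}. -/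
open Finset

/-- The principal minor of `A` indexed by `U`. -/
noncomputable def pMinor {n : ℕ} (A : Matrix (Fin n) (Fin n) ℝ) (U : Finset (Fin n)) : ℝ :=
  subDet A U U

open scoped MatrixOrder in
lemma gram_aux {n : ℕ} (M : Matrix (Fin n) (Fin n) ℝ) (hM : M.PosSemidef) :
    ∃ B : Matrix (Fin n) (Fin n) ℝ, M = B.conjTranspose * B := by
  exact CStarAlgebra.nonneg_iff_eq_star_mul_self.mp hM.nonneg

lemma quad_aux (p q s r : ℝ) (hq : 0 ≤ q) (hs : 0 ≤ s) (hp : 0 ≤ p)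
    (h1 : p ≤ q + s) (h2 : q ≤ p + s) (h3 : s ≤ p + q) :
    r * p ^ 2 ≤ (r + 1) * s ^ 2 + r * (r + 1) * q ^ 2 := by
  have e1 : p ^ 2 ≤ (q + s) ^ 2 := by gcongr
  have e2 : (q - s) ^ 2 ≤ p ^ 2 := by
    apply sq_le_sq'  <;> linarith
  rcases le_total 0 r with hr | hr
  · nlinarith [sq_nonneg (r * q - s), mul_le_mul_of_nonneg_left e1 hr]
  · nlinarith [sq_nonneg (r * q + s), mul_le_mul_of_nonpos_left e2 hr]

lemma four_aux {n : ℕ} (M : Matrix (Fin n) (Fin n) ℝ) (hM : M.PosSemidef)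
    (a b c d : Fin n) (r : ℝ) :
    r * ((M a a * M b b - M a b * M b a) * (M c c * M d d - M c d * M d c)) ≤
      (r + 1) * ((M a a * M d d - M a d * M d a) * (M b b * M c c - M b c * M c b)) +
      r * (r + 1) * ((M a a * M c c - M a c * M c a) * (M b b * M d d - M b d * M d b)) := by
  obtain ⟨B, hB⟩ := gram_aux M hM
  have hMe : ∀ i j, M i j = ∑ p, B p i * B p j := by
    intro i j; rw [hB]; simp [Matrix.mul_apply]
  have hsymm : ∀ i j, M i j = M j i := by
    intro i j; rw [hMe, hMe]; simp only [mul_comm]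
  have hz : ∀ i, M i i = 0 → ∀ j, M i j = 0 := by
    intro i hi j
    rw [hMe] at hi ⊢
    have := (Finset.sum_eq_zero_iff_of_nonneg (fun p _ => mul_self_nonneg (B p i))).mp hi
    apply Finset.sum_eq_zero
    intro p hp
    rw [mul_self_eq_zero.mp (this p hp), zero_mul]
  have hz' : ∀ i, M i i = 0 → ∀ j, M j i = 0 := fun i hi j => by rw [hsymm]; exact hz i hi j
  by_cases ha : M a a = 0
  · simp [hz a ha]
  by_cases hb : M b b = 0
  · simp [hz b hb, hz' b hb]
  by_cases hc : M c c = 0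
  · simp [hz c hc, hz' c hc]
  by_cases hd : M d d = 0
  · simp [hz d hd, hz' d hd]
  have hnn : ∀ i, 0 ≤ M i i := fun i => hM.diag_nonneg
  let w : Fin n → EuclideanSpace ℝ (Fin n × Fin n) := fun i =>
    WithLp.toLp 2 fun p => B p.1 i * B p.2 i / M i i
  have hin : ∀ i j, inner ℝ (w i) (w j) = M i j ^ 2 / (M i i * M j j) := by
    intro i j
    simp only [w, PiLp.inner_apply, RCLike.inner_apply, conj_trivial]
    rw [Fintype.sum_prod_type, hMe i j, sq, Finset.sum_mul_sum, Finset.sum_div]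
    refine Finset.sum_congr rfl fun p _ => ?_
    rw [Finset.sum_div]
    refine Finset.sum_congr rfl fun q _ => ?_
    rw [div_mul_div_comm]
    congr 1 <;> ring
  have hdist : ∀ i j, M i i ≠ 0 → M j j ≠ 0 →
      M i i * M j j - M i j * M j i = M i i * M j j / 2 * dist (w i) (w j) ^ 2 := by
    intro i j hi hj
    rw [dist_eq_norm, norm_sub_sq_real, ← real_inner_self_eq_norm_sq,
      ← real_inner_self_eq_norm_sq, hin, hin, hin, hsymm j i]
    field_simp
    ring
  have key := quad_aux (dist (w a) (w b) * dist (w c) (w d))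
    (dist (w a) (w c) * dist (w b) (w d)) (dist (w a) (w d) * dist (w b) (w c)) r
    (by positivity) (by positivity) (by positivity)
    (by have := EuclideanGeometry.mul_dist_le_mul_dist_add_mul_dist (w a) (w c) (w b) (w d)
        simp only [dist_comm (w c) (w b)] at this
        linarith)
    (by have := EuclideanGeometry.mul_dist_le_mul_dist_add_mul_dist (w a) (w b) (w c) (w d)
        linarith)
    (by have := EuclideanGeometry.mul_dist_le_mul_dist_add_mul_dist (w a) (w b) (w d) (w c)
        simp only [dist_comm (w d) (w c), dist_comm (w d) (w b)] at this
        linarith)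
  rw [hdist a b ha hb, hdist c d hc hd, hdist a d ha hd, hdist b c hb hc,
    hdist a c ha hc, hdist b d hb hd]
  have hK : 0 ≤ M a a * M b b * M c c * M d d / 4 := by
    have := hnn a; have := hnn b; have := hnn c; have := hnn d
    positivity
  have := mul_le_mul_of_nonneg_left key hK
  linarith

lemma pMinor_eq {n : ℕ} (A : Matrix (Fin n) (Fin n) ℝ) (U : Finset (Fin n))
    {m : Type*} [Fintype m] [DecidableEq m] (f : m → Fin n) (hf : Function.Injective f)
    (hU : ∀ x, x ∈ U ↔ ∃ i, f i = x) :
    pMinor A U = (A.submatrix f f).det := by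
  unfold pMinor subDet
  rw [dif_pos rfl]
  let g : m ≃ U := Equiv.ofBijective (fun i => ⟨f i, (hU _).2 ⟨i, rfl⟩⟩)
    ⟨fun i j h => hf (Subtype.ext_iff.mp h), fun ⟨x, hx⟩ => by
      obtain ⟨i, hi⟩ := (hU x).1 hx
      exact ⟨i, Subtype.ext hi⟩⟩
  let e : Fin U.card ≃ m := (U.orderIsoOfFin rfl).toEquiv.trans g.symm
  have he : ∀ i, f (e i) = U.orderEmbOfFin rfl i := by
    intro i
    have : ((g (e i) : U) : Fin n) = U.orderEmbOfFin rfl i := by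
      simp [e]
    exact this
  rw [← Matrix.det_submatrix_equiv_self e]
  congr 1
  ext i j
  simp [he]

lemma pMinor_pair {n : ℕ} (A : Matrix (Fin n) (Fin n) ℝ) (hA : A.PosDef)
    (S : Finset (Fin n)) : ∃ (k : ℝ) (M : Matrix (Fin n) (Fin n) ℝ), M.PosSemidef ∧
    ∀ a b, a ∉ S → b ∉ S → a ≠ b →
      pMinor A (S ∪ {a, b}) = k * (M a a * M b b - M a b * M b a) := by
  let v : S → Fin n := Subtype.val
  let P := A.submatrix v v
  let Q := A.submatrix v id
  have hP : P.PosDef := hA.submatrix Subtype.val_injective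
  have hQ : Q.conjTranspose = A.submatrix id v := by
    rw [Matrix.conjTranspose_submatrix, hA.isHermitian.eq]
  have : Invertible P := hP.isUnit.invertible
  refine ⟨P.det, A - Q.conjTranspose * P⁻¹ * Q, ?_, ?_⟩
  · rw [← Matrix.PosDef.fromBlocks₁₁ Q A hP, hQ]
    have := hA.posSemidef.submatrix (Sum.elim v id)
    have heq : Matrix.fromBlocks P Q (A.submatrix id v) A =
        A.submatrix (Sum.elim v id) (Sum.elim v id) := by
      ext (i | i) (j | j) <;> rfl
    rw [heq]
    exact this
  · intro a b ha hb hab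
    rw [pMinor_eq A _ (Sum.elim v ![a, b])]
    · have : A.submatrix (Sum.elim v ![a, b]) (Sum.elim v ![a, b]) =
        Matrix.fromBlocks P (A.submatrix v ![a, b]) (A.submatrix ![a, b] v)
          (A.submatrix ![a, b] ![a, b]) := by
        ext (i | i) (j | j) <;> rfl
      rw [this, Matrix.det_fromBlocks₁₁, hQ, Matrix.invOf_eq_nonsing_inv]
      congr 1
      rw [Matrix.det_fin_two]
      rfl
    · rintro (i | i) (j | j) h
      · simp only [Sum.elim_inl] at h
        rw [Subtype.ext h]
      · exfalso
        have := i.2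
        simp only [Sum.elim_inl, Sum.elim_inr, v] at h
        rw [h] at this
        fin_cases j
        · exact ha this
        · exact hb this
      · exfalso
        have := j.2
        simp only [Sum.elim_inl, Sum.elim_inr, v] at h
        rw [← h] at this
        fin_cases i
        · exact ha this
        · exact hb this
      · fin_cases i <;> fin_cases j <;> simp_all
    · intro x
      simp [v, eq_comm]
      tauto

theorem psd_principal_minor_inequality_four
    {n : ℕ} (A : Matrix (Fin n) (Fin n) ℝ) (hA : A.PosSemidef)
    (S : Finset (Fin n)) (a b c d : Fin n)
    (haS : a ∉ S) (hbS : b ∉ S) (hcS : c ∉ S) (hdS : d ∉ S)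
    (hab : a ≠ b) (hac : a ≠ c) (had : a ≠ d)
    (hbc : b ≠ c) (hbd : b ≠ d) (hcd : c ≠ d) :
    ∀ r : ℝ,
      r * (pMinor A (S ∪ {a, b}) * pMinor A (S ∪ {c, d})) ≤
        (r + 1) * (pMinor A (S ∪ {a, d}) * pMinor A (S ∪ {b, c})) +
          r * (r + 1) * (pMinor A (S ∪ {a, c}) * pMinor A (S ∪ {b, d})) := by
  intro r
  have hcont : ∀ U, Continuous fun t : ℝ => pMinor (A + t • (1 : Matrix (Fin n) (Fin n) ℝ)) U := by
    intro U
    unfold pMinor subDet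
    simp only [dif_pos]
    apply Continuous.matrix_det
    apply continuous_matrix
    intro i j
    simp only [Matrix.of_apply, Matrix.add_apply, Matrix.smul_apply]
    fun_prop
  let F : ℝ → ℝ := fun t =>
    let A' := A + t • (1 : Matrix (Fin n) (Fin n) ℝ)
    (r + 1) * (pMinor A' (S ∪ {a, d}) * pMinor A' (S ∪ {b, c})) +
      r * (r + 1) * (pMinor A' (S ∪ {a, c}) * pMinor A' (S ∪ {b, d})) -
      r * (pMinor A' (S ∪ {a, b}) * pMinor A' (S ∪ {c, d}))
  have hF : Continuous F := by
    have := hcont (S ∪ {a, d}); have := hcont (S ∪ {b, c}); have := hcont (S ∪ {a, c})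
    have := hcont (S ∪ {b, d}); have := hcont (S ∪ {a, b}); have := hcont (S ∪ {c, d})
    simp only [F]
    fun_prop
  have hpos : ∀ t : ℝ, 0 < t → 0 ≤ F t := by
    intro t ht
    have hA' : (A + t • (1 : Matrix (Fin n) (Fin n) ℝ)).PosDef :=
      Matrix.PosDef.posSemidef_add hA (Matrix.PosDef.one.smul ht)
    obtain ⟨k, M, hM, h⟩ := pMinor_pair _ hA' S
    have key := four_aux M hM a b c d r
    simp only [F]
    rw [h a b haS hbS hab, h c d hcS hdS hcd, h a d haS hdS had, h b c hbS hcS hbc,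
      h a c haS hcS hac, h b d hbS hdS hbd]
    have := mul_le_mul_of_nonneg_left key (mul_self_nonneg k)
    linarith
  have h0 : 0 ≤ F 0 := by
    have ht : Filter.Tendsto F (nhdsWithin 0 (Set.Ioi 0)) (nhds (F 0)) :=
      hF.continuousAt.tendsto.mono_left nhdsWithin_le_nhds
    refine ge_of_tendsto ht ?_
    filter_upwards [self_mem_nhdsWithin] with t ht using hpos t ht
  simp only [F, zero_smul, add_zero] at h0
  linarith
end

section
/- Let A be an n×n real symmetric positive semidefinite matrix, let S ⊆ [n], and let a,b,c ∈ [n]∖S be pairwise distinct. Then for every r ∈ ℝ: (r+1)·A_{S∪{a}}·A_{S∪{b,c}} + r(r+1)·A_{S∪{b}}·A_{S∪{a,c}} ≥ r·A_{S∪{c}}·A_{S∪{a,b}}. -/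
open Finset

open Matrix in
lemma pMinor_eq_aux {n : ℕ} (A : Matrix (Fin n) (Fin n) ℝ) (U : Finset (Fin n))
    {ι : Type} [Fintype ι] [DecidableEq ι] (f : ι → Fin n) (hf : Function.Injective f)
    (hU : Set.range f = (U : Set (Fin n))) :
    pMinor A U = (A.submatrix f f).det := by
  unfold pMinor subDet
  rw [dif_pos rfl]
  let g : Fin U.card → Fin n := U.orderEmbOfFin rfl
  have hg : Function.Injective g := (U.orderEmbOfFin rfl).injective
  have hgr : Set.range g = (U : Set (Fin n)) := Finset.range_orderEmbOfFin U rfl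
  let e : Fin U.card ≃ ι := (Equiv.ofInjective g hg).trans
    ((Equiv.setCongr (hgr.trans hU.symm)).trans (Equiv.ofInjective f hf).symm)
  have he : ∀ i, f (e i) = g i := by
    intro i
    have := Equiv.apply_ofInjective_symm hf
      ((Equiv.setCongr (hgr.trans hU.symm)) (Equiv.ofInjective g hg i))
    exact this
  rw [← Matrix.det_submatrix_equiv_self e (A.submatrix f f)]
  congr 1
  ext i j
  simp only [Matrix.of_apply, Matrix.submatrix_apply, he]
  rfl

lemma continuous_pMinor_aux {n : ℕ} (A : Matrix (Fin n) (Fin n) ℝ) (U : Finset (Fin n)) :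
    Continuous fun ε : ℝ => pMinor (A + ε • (1 : Matrix (Fin n) (Fin n) ℝ)) U := by
  unfold pMinor subDet
  simp only [dif_pos]
  apply Continuous.matrix_det
  apply continuous_matrix
  intro i j
  simp only [Matrix.of_apply, Matrix.add_apply, Matrix.smul_apply]
  fun_prop

lemma quad_aux_s15 (P Q R r : ℝ) (hP : 0 ≤ P) (hR : 0 ≤ R) (h : Q ^ 2 ≤ 4 * P * R) :
    0 ≤ P * r ^ 2 + Q * r + R := by
  rcases hP.eq_or_lt with h0 | h0
  · subst h0
    have : Q = 0 := by
      have : Q ^ 2 ≤ 0 := by linarith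
      exact pow_eq_zero_iff (two_ne_zero) |>.1 (le_antisymm this (sq_nonneg _))
    subst this
    simpa using hR
  · have : 0 ≤ (4 * P) * (P * r ^ 2 + Q * r + R) := by nlinarith [sq_nonneg (2 * P * r + Q)]
    exact nonneg_of_mul_nonneg_right this (by linarith)

lemma three_aux (x y z p q s r : ℝ) (hx : 0 ≤ x) (hy : 0 ≤ y) (hz : 0 ≤ z)
    (h1 : 0 ≤ x * y - p ^ 2) (h2 : 0 ≤ x * z - q ^ 2) (h3 : 0 ≤ y * z - s ^ 2)
    (hD : 0 ≤ x * y * z + 2 * p * q * s - x * s ^ 2 - y * q ^ 2 - z * p ^ 2) :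
    r * (z * (x * y - p ^ 2)) ≤ (r + 1) * (x * (y * z - s ^ 2)) +
      r * (r + 1) * (y * (x * z - q ^ 2)) := by
  suffices h : (x * y * z + z * p ^ 2 - x * s ^ 2 - y * q ^ 2) ^ 2 ≤
      4 * (y * (x * z - q ^ 2)) * (x * (y * z - s ^ 2)) by
    have := quad_aux_s15 _ _ _ r (mul_nonneg hy h2) (mul_nonneg hx h3) h
    nlinarith
  rcases hz.eq_or_lt with h0 | h0
  · subst h0
    have hq : q = 0 := by
      have : q ^ 2 ≤ 0 := by linarith
      exact pow_eq_zero_iff (two_ne_zero) |>.1 (le_antisymm this (sq_nonneg _))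
    have hs : s = 0 := by
      have : s ^ 2 ≤ 0 := by linarith
      exact pow_eq_zero_iff (two_ne_zero) |>.1 (le_antisymm this (sq_nonneg _))
    subst hq hs
    simp
  obtain ⟨u, hu, hu2⟩ : ∃ u : ℝ, 0 ≤ u ∧ u ^ 2 = y * z - s ^ 2 :=
    ⟨_, Real.sqrt_nonneg _, Real.sq_sqrt h3⟩
  obtain ⟨v, hv, hv2⟩ : ∃ v : ℝ, 0 ≤ v ∧ v ^ 2 = x * z - q ^ 2 :=
    ⟨_, Real.sqrt_nonneg _, Real.sq_sqrt h2⟩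
  set Q := x * y * z + z * p ^ 2 - x * s ^ 2 - y * q ^ 2 with hQ
  obtain ⟨t, ht⟩ : ∃ t, t = z * p - q * s := ⟨_, rfl⟩
  have hzQ : z * Q = (u * v) ^ 2 + t ^ 2 + 2 * t * (q * s) := by
    rw [mul_pow, hu2, hv2, ht, hQ]; ring
  have htm : t ^ 2 ≤ (u * v) ^ 2 := by
    have : (u * v) ^ 2 - t ^ 2 =
        z * (x * y * z + 2 * p * q * s - x * s ^ 2 - y * q ^ 2 - z * p ^ 2) := by
      rw [mul_pow, hu2, hv2, ht]; ring
    have := mul_nonneg hz hD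
    linarith
  have huv : 0 ≤ u * v := mul_nonneg hu hv
  have htm' : |t| ≤ u * v := abs_le_of_sq_le_sq htm huv
  have hw := abs_nonneg (q * s)
  have hb : |t * (q * s)| ≤ u * v * |q * s| := by
    rw [abs_mul]; exact mul_le_mul_of_nonneg_right htm' hw
  have hb' := abs_le.1 hb
  have hQb : |z * Q| ≤ 2 * (u * v) * (u * v + |q * s|) := by
    rw [hzQ, abs_le]
    constructor <;> nlinarith [sq_nonneg t, sq_nonneg (u * v)]
  have hC : (u * v + |q * s|) ^ 2 ≤ (u ^ 2 + s ^ 2) * (v ^ 2 + q ^ 2) := by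
    rw [abs_mul]
    have e1 := sq_abs q
    have e2 := sq_abs s
    nlinarith [sq_nonneg (u * |q| - v * |s|)]
  have hfin : z ^ 2 * Q ^ 2 ≤ z ^ 2 * (4 * (y * (x * z - q ^ 2)) * (x * (y * z - s ^ 2))) := by
    calc z ^ 2 * Q ^ 2 = |z * Q| ^ 2 := by rw [sq_abs]; ring
      _ ≤ (2 * (u * v) * (u * v + |q * s|)) ^ 2 := pow_le_pow_left₀ (abs_nonneg _) hQb 2
      _ = 4 * (u * v) ^ 2 * (u * v + |q * s|) ^ 2 := by ring
      _ ≤ 4 * (u * v) ^ 2 * ((u ^ 2 + s ^ 2) * (v ^ 2 + q ^ 2)) :=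
        mul_le_mul_of_nonneg_left hC (by positivity)
      _ = _ := by rw [mul_pow, hu2, hv2]; ring
  exact le_of_mul_le_mul_left hfin (by positivity)

open Matrix in
lemma schur_aux {n : ℕ} (A : Matrix (Fin n) (Fin n) ℝ) (hA : A.PosDef) (S : Finset (Fin n)) :
    ∃ C : Matrix (Fin n) (Fin n) ℝ, ∃ d : ℝ, C.PosSemidef ∧
      ∀ (k : ℕ) (f : Fin k → Fin n) (T : Finset (Fin n)), Function.Injective f →
        Set.range f = (T : Set (Fin n)) → Disjoint S T →
        pMinor A (S ∪ T) = d * (C.submatrix f f).det := by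
  classical
  let v : S → Fin n := Subtype.val
  have hB : (A.submatrix v v).PosDef := hA.submatrix Subtype.val_injective
  have : Invertible (A.submatrix v v) := hB.isUnit.invertible
  refine ⟨A - (A.submatrix v id)ᴴ * (A.submatrix v v)⁻¹ * A.submatrix v id,
    (A.submatrix v v).det, ?_, ?_⟩
  · rw [← Matrix.PosDef.fromBlocks₁₁ _ _ hB]
    have := hA.posSemidef.submatrix (Sum.elim v id)
    have e : A.submatrix (Sum.elim v id) (Sum.elim v id) =
        Matrix.fromBlocks (A.submatrix v v) (A.submatrix v id) (A.submatrix v id)ᴴ A := by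
      ext i j
      rcases i with i | i <;> rcases j with j | j
      · rfl
      · rfl
      · exact (hA.isHermitian.apply _ _).symm
      · rfl
    rw [e] at this
    exact this
  · intro k f T hf hT hST
    rw [pMinor_eq_aux A (S ∪ T) (Sum.elim v f)]
    · have : A.submatrix (Sum.elim v f) (Sum.elim v f) =
        Matrix.fromBlocks (A.submatrix v v) (A.submatrix v f) (A.submatrix f v)
          (A.submatrix f f) := by
        ext i j
        rcases i with i | i <;> rcases j with j | j <;> rfl
      rw [this, Matrix.det_fromBlocks₁₁, Matrix.invOf_eq_nonsing_inv]
      congr 2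
      have h2 : A.submatrix f v = ((A.submatrix v id)ᴴ).submatrix f id := by
        ext i j
        simp only [Matrix.submatrix_apply, Matrix.conjTranspose_apply, id]
        exact (hA.isHermitian.apply _ _).symm
      rw [h2]
      ext i j
      simp [Matrix.mul_apply]
    · refine Function.Injective.sumElim Subtype.val_injective hf ?_
      intro i j h
      have h2 : f j ∈ T := by
        have : f j ∈ Set.range f := ⟨j, rfl⟩
        rwa [hT] at this
      have h1 : f j ∈ S := h ▸ i.2
      exact (Finset.disjoint_left.1 hST) h1 h2
    · rw [Set.Sum.elim_range, hT]
      simp [v]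

lemma posdef_aux
    {n : ℕ} (A : Matrix (Fin n) (Fin n) ℝ) (hA : A.PosDef)
    (S : Finset (Fin n)) (a b c : Fin n)
    (haS : a ∉ S) (hbS : b ∉ S) (hcS : c ∉ S)
    (hab : a ≠ b) (hac : a ≠ c) (hbc : b ≠ c) (r : ℝ) :
      r * (pMinor A (S ∪ {c}) * pMinor A (S ∪ {a, b})) ≤
        (r + 1) * (pMinor A (S ∪ {a}) * pMinor A (S ∪ {b, c})) +
          r * (r + 1) * (pMinor A (S ∪ {b}) * pMinor A (S ∪ {a, c})) := by
  obtain ⟨C, d, hC, h⟩ := schur_aux A hA S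
  have one : ∀ i, i ∉ S → pMinor A (S ∪ {i}) = d * C i i := by
    intro i hi
    rw [h 1 ![i] {i} (Function.injective_of_subsingleton _) (by simp) (by simpa using hi)]
    rw [Matrix.det_fin_one]
    simp
  have two : ∀ i j, i ≠ j → i ∉ S → j ∉ S →
      pMinor A (S ∪ {i, j}) = d * (C i i * C j j - C i j ^ 2) := by
    intro i j hij hi hj
    have e : C j i = C i j := hC.isHermitian.apply i j
    rw [h 2 ![i, j] {i, j} (by
        intro x y; fin_cases x <;> fin_cases y <;> simp [hij, hij.symm])
      (by simp [Matrix.range_cons, Set.pair_comm]) (by simp [hi, hj])]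
    rw [Matrix.det_fin_two]
    simp [e]
    left; ring
  have m2 : ∀ i j, 0 ≤ C i i * C j j - C i j ^ 2 := by
    intro i j
    have e : C j i = C i j := hC.isHermitian.apply i j
    have := (hC.submatrix ![i, j]).det_nonneg
    rw [Matrix.det_fin_two] at this
    simp [e] at this
    nlinarith
  have m3 := (hC.submatrix ![a, b, c]).det_nonneg
  have e1 : C b a = C a b := hC.isHermitian.apply a b
  have e2 : C c a = C a c := hC.isHermitian.apply a c
  have e3 : C c b = C b c := hC.isHermitian.apply b c
  rw [Matrix.det_fin_three] at m3
  simp [e1, e2, e3] at m3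
  have key := three_aux (C a a) (C b b) (C c c) (C a b) (C a c) (C b c) r
    hC.diag_nonneg hC.diag_nonneg hC.diag_nonneg (m2 _ _) (m2 _ _) (m2 _ _) (by nlinarith)
  rw [one a haS, one b hbS, one c hcS, two a b hab haS hbS, two a c hac haS hcS,
    two b c hbc hbS hcS]
  have := mul_le_mul_of_nonneg_left key (sq_nonneg d)
  nlinarith

theorem psd_principal_minor_inequality_three
    {n : ℕ} (A : Matrix (Fin n) (Fin n) ℝ) (hA : A.PosSemidef)
    (S : Finset (Fin n)) (a b c : Fin n)
    (haS : a ∉ S) (hbS : b ∉ S) (hcS : c ∉ S)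
    (hab : a ≠ b) (hac : a ≠ c) (hbc : b ≠ c) :
    ∀ r : ℝ,
      r * (pMinor A (S ∪ {c}) * pMinor A (S ∪ {a, b})) ≤
        (r + 1) * (pMinor A (S ∪ {a}) * pMinor A (S ∪ {b, c})) +
          r * (r + 1) * (pMinor A (S ∪ {b}) * pMinor A (S ∪ {a, c})) := by
  intro r
  rw [← sub_nonneg]
  let g : ℝ → ℝ := fun ε =>
    (r + 1) * (pMinor (A + ε • (1 : Matrix (Fin n) (Fin n) ℝ)) (S ∪ {a}) *
      pMinor (A + ε • (1 : Matrix (Fin n) (Fin n) ℝ)) (S ∪ {b, c})) +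
    r * (r + 1) * (pMinor (A + ε • (1 : Matrix (Fin n) (Fin n) ℝ)) (S ∪ {b}) *
      pMinor (A + ε • (1 : Matrix (Fin n) (Fin n) ℝ)) (S ∪ {a, c})) -
    r * (pMinor (A + ε • (1 : Matrix (Fin n) (Fin n) ℝ)) (S ∪ {c}) *
      pMinor (A + ε • (1 : Matrix (Fin n) (Fin n) ℝ)) (S ∪ {a, b}))
  have hg : Continuous g := by
    have := continuous_pMinor_aux A
    have h1 := this (S ∪ {a})
    have h2 := this (S ∪ {b})
    have h3 := this (S ∪ {c})
    have h4 := this (S ∪ {a, b})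
    have h5 := this (S ∪ {a, c})
    have h6 := this (S ∪ {b, c})
    exact ((continuous_const.mul (h1.mul h6)).add (continuous_const.mul (h2.mul h5))).sub
      (continuous_const.mul (h3.mul h4))
  have hpos : ∀ ε : ℝ, 0 < ε → 0 ≤ g ε := by
    intro ε hε
    have hP : (A + ε • (1 : Matrix (Fin n) (Fin n) ℝ)).PosDef :=
      Matrix.PosDef.posSemidef_add hA (Matrix.PosDef.one.smul hε)
    exact sub_nonneg.2 (posdef_aux _ hP S a b c haS hbS hcS hab hac hbc r)
  have h0 : 0 ≤ g 0 := by
    have ht : Filter.Tendsto g (nhdsWithin 0 (Set.Ioi 0)) (nhds (g 0)) :=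
      (hg.tendsto 0).mono_left nhdsWithin_le_nhds
    refine ge_of_tendsto ht ?_
    filter_upwards [self_mem_nhdsWithin] with ε hε using hpos ε hε
  simpa [g] using h0
end

section
/- For real numbers x, y, z, the inequality (r+1)·x + r(r+1)·y ≥ r·z holds for all r ∈ ℝ if and only if 2(xy + xz + yz) ≥ x² + y² + z² and x + y + z ≥ 0. -/
theorem linear_inequalities_cut_quadratic_cone (x y z : ℝ) :
    (∀ r : ℝ, r * z ≤ (r + 1) * x + r * (r + 1) * y) ↔
      (x ^ 2 + y ^ 2 + z ^ 2 ≤ 2 * (x * y + x * z + y * z) ∧ 0 ≤ x + y + z) := by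
  constructor
  · intro h
    have hd : discrim y (x + y - z) x ≤ 0 :=
      discrim_le_zero (fun r => by have := h r; linarith)
    unfold discrim at hd
    have hx : 0 ≤ x := by have := h 0; linarith
    have hz : 0 ≤ z := by have := h (-1); linarith
    refine ⟨by linarith, ?_⟩
    have hy : 0 ≤ y := by
      by_contra hy
      push Not at hy
      have h1 : 0 ≤ y * x := by linarith [sq_nonneg (x + y - z)]
      have hx0 : x = 0 := by
        by_contra hne
        have : 0 < x := lt_of_le_of_ne hx (Ne.symm hne)
        linarith [mul_neg_of_neg_of_pos hy this]
      subst hx0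
      nlinarith
    linarith
  · rintro ⟨h, hs⟩ r
    have hxy : 0 ≤ x * y := by nlinarith [sq_nonneg (x + y - z)]
    have hyz : 0 ≤ y * z := by nlinarith [sq_nonneg (y + z - x)]
    have hy : 0 ≤ y := by
      by_contra hy
      push Not at hy
      have h1 : x ≤ 0 := by
        by_contra hc
        push Not at hc
        linarith [mul_neg_of_pos_of_neg hc hy]
      have h2 : z ≤ 0 := by
        by_contra hc
        push Not at hc
        linarith [mul_neg_of_neg_of_pos hy hc]
      linarith
    rcases hy.eq_or_lt with h0 | h0
    · subst h0
      have h1 : (x - z) ^ 2 ≤ 0 := by linarith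
      have h2 : x - z = 0 := by
        exact pow_eq_zero_iff (two_ne_zero) |>.1 (le_antisymm h1 (sq_nonneg _))
      have h3 : z = x := by linarith
      subst h3
      linarith
    · have key : 0 ≤ y * ((r + 1) * x + r * (r + 1) * y - r * z) := by
        nlinarith [sq_nonneg (2 * y * r + (x + y - z))]
      linarith [nonneg_of_mul_nonneg_right key h0]
end

section
/- Let K be a field with a valuation-like map ν and let B be an n×n matrix over K. Suppose that for each nonempty S ⊆ [n] there is a real number w(S) such that ν(det B(T,S)) = w(S) for every T ⊆ [n] with |T| = |S|, and set w(∅) = 0. Then the function w : 2^{[n]} → ℝ is M♮-concave. -/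
open Finset

/-- M♮-concavity of a function on subsets of `[n]`. -/
def MNatConcave {n : ℕ} (F : Finset (Fin n) → ℝ) : Prop :=
  ∀ S T : Finset (Fin n), ∀ i ∈ S, i ∉ T →
    (F S + F T ≤ F (S.erase i) + F (insert i T) ∨
      ∃ j ∈ T, j ∉ S ∧
        F S + F T ≤ F (insert j (S.erase i)) + F ((insert i T).erase j))

/-- Columns of `B` on `S`, permuted unit vectors elsewhere. -/
def mixMat {K : Type*} [CommRing K] {n : ℕ} (B : Matrix (Fin n) (Fin n) K)
    (σ : Equiv.Perm (Fin n)) (S : Finset (Fin n)) : Matrix (Fin n) (Fin n) K :=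
  Matrix.of fun r c => if c ∈ S then B r c else if r = σ c then 1 else 0

lemma det_pm {K : Type*} [CommRing K] {m : Type*} [Fintype m] [DecidableEq m]
    (M : Matrix m m K) (τ : Equiv.Perm m) :
    (M.submatrix τ id).det = M.det ∨ (M.submatrix τ id).det = -M.det := by
  rw [Matrix.det_permute]
  rcases Int.units_eq_one_or (Equiv.Perm.sign τ) with h | h <;> simp [h]

lemma det_pm' {K : Type*} [CommRing K] {m : Type*} [Fintype m] [DecidableEq m]
    (M : Matrix m m K) (τ : Equiv.Perm m) :
    (M.submatrix id τ).det = M.det ∨ (M.submatrix id τ).det = -M.det := by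
  rw [Matrix.det_permute']
  rcases Int.units_eq_one_or (Equiv.Perm.sign τ) with h | h <;> simp [h]

lemma mix_det {K : Type*} [CommRing K] {n : ℕ} (B : Matrix (Fin n) (Fin n) K)
    (σ : Equiv.Perm (Fin n)) (S : Finset (Fin n)) :
    (mixMat B σ S).det = subDet B (S.map σ.toEmbedding) S ∨
    (mixMat B σ S).det = - subDet B (S.map σ.toEmbedding) S := by
  have h1 := det_pm (mixMat B σ S) σ
  have hc : (S.map σ.toEmbedding).card = S.card := Finset.card_map _
  set T := S.map σ.toEmbedding with hT
  let Y : Matrix {x // x ∈ S} {x // x ∈ S} K := Matrix.of fun a b => B (σ a) b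
  have h2 : ((mixMat B σ S).submatrix σ id).det = Y.det := by
    rw [Matrix.twoBlockTriangular_det' _ (fun x => x ∈ S)]
    · have e1 : Matrix.toSquareBlockProp ((mixMat B σ S).submatrix σ id) (fun x => x ∈ S) = Y := by
        ext a b
        simp [Matrix.toSquareBlockProp, mixMat, Y]
      have e2 : Matrix.toSquareBlockProp ((mixMat B σ S).submatrix σ id) (fun x => ¬ x ∈ S) = 1 := by
        ext a b
        have := b.2
        simp [Matrix.toSquareBlockProp, mixMat, Matrix.one_apply, this, Subtype.ext_iff]
      rw [e1, e2, Matrix.det_one, mul_one]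
      congr!
    · intro i hi j hj
      have : i ≠ j := fun h => hj (h ▸ hi)
      simp [mixMat, hj, this]
  let eS : Fin S.card ≃ {x // x ∈ S} := (S.orderIsoOfFin rfl).toEquiv
  let eT : Fin S.card ≃ {x // x ∈ T} := (T.orderIsoOfFin hc).toEquiv
  let s : {x // x ∈ S} ≃ {x // x ∈ T} := σ.subtypeEquiv (by intro a; simp [hT])
  let τ : Equiv.Perm (Fin S.card) := (eT.trans s.symm).trans eS.symm
  have h3 := det_pm (Y.submatrix eS eS) τ
  rw [Matrix.det_submatrix_equiv_self] at h3
  have h4 : subDet B T S = ((Y.submatrix eS eS).submatrix τ id).det := by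
    unfold subDet
    rw [dif_pos hc]
    congr 1
    ext i j
    have : (σ (eS (τ i) : Fin n)) = T.orderEmbOfFin hc i := by
      have : s (eS (τ i)) = eT i := by simp [τ]
      exact congrArg Subtype.val this
    simp only [Matrix.of_apply, Matrix.submatrix_apply, Y, this, id]
    rfl
  rw [← h4] at h3
  rw [h2] at h1
  grind

lemma plucker {K : Type*} [CommRing K] {n : ℕ} (A C : Matrix (Fin n) (Fin n) K) (i : Fin n) :
    A.det * C.det = ∑ k, (A.updateCol i (fun r => C r k)).det *
      (C.updateCol k (fun r => A r i)).det := by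
  have h := Matrix.mulVec_cramer C (fun r => A r i)
  have e : A.updateCol i (fun r => A r i) = A := Matrix.updateCol_eq_self A i
  have h2 : (A.updateCol i (C.mulVec (Matrix.cramer C fun r => A r i))).det = C.det * A.det := by
    rw [h, Matrix.det_updateCol_smul, e]
  rw [mul_comm, ← h2]
  have : C.mulVec (Matrix.cramer C fun r => A r i) =
      ∑ k, (C.updateCol k (fun r => A r i)).det • (fun r => C r k) := by
    ext r
    simp [Matrix.mulVec, dotProduct, Matrix.cramer_apply, mul_comm]
  rw [this, ← Matrix.cramer_apply, map_sum, Finset.sum_apply]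
  refine Finset.sum_congr rfl fun k _ => ?_
  rw [Matrix.cramer_apply, Matrix.det_updateCol_smul, mul_comm]

lemma val_sum {K : Type*} [Field K] (ν : K → WithBot ℝ)
    (hν0 : ∀ x : K, ν x = ⊥ ↔ x = 0)
    (hνadd : ∀ a b : K, ν (a + b) ≤ max (ν a) (ν b)) {ι : Type*} [DecidableEq ι] (s : Finset ι)
    (f : ι → K) (h : ∑ k ∈ s, f k ≠ 0) : ∃ k ∈ s, ν (∑ k ∈ s, f k) ≤ ν (f k) := by
  induction s using Finset.induction_on with
  | empty => simp at h
  | insert a s ha ih =>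
    rw [Finset.sum_insert ha] at h ⊢
    by_cases h0 : ∑ k ∈ s, f k = 0
    · exact ⟨a, by simp, by simp [h0]⟩
    · obtain ⟨k, hk, hle⟩ := ih h0
      rcases le_max_iff.1 (hνadd (f a) (∑ k ∈ s, f k)) with h | h
      · exact ⟨a, by simp, h⟩
      · exact ⟨k, by simp [hk], h.trans hle⟩

theorem row_independent_minor_valuations_MNatConcave
    {K : Type*} [Field K] (ν : K → WithBot ℝ)
    (hν0 : ∀ x : K, ν x = ⊥ ↔ x = 0)
    (hνmul : ∀ a b : K, ν (a * b) = ν a + ν b)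
    (hνadd : ∀ a b : K, ν (a + b) ≤ max (ν a) (ν b))
    {n : ℕ} (B : Matrix (Fin n) (Fin n) K)
    (w : Finset (Fin n) → ℝ) (hw0 : w ∅ = 0)
    (hw : ∀ S : Finset (Fin n), S.Nonempty → ∀ T : Finset (Fin n),
      T.card = S.card → ν (subDet B T S) = (w S : WithBot ℝ)) :
    MNatConcave w := by
  have hne1 : ν 1 = 0 := by
    have h := hνmul 1 1
    have h1 : ν 1 ≠ ⊥ := by simp [hν0]
    obtain ⟨x, hx⟩ := WithBot.ne_bot_iff_exists.1 h1
    rw [mul_one, ← hx] at h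
    rw [← hx]
    norm_cast at h ⊢
    linarith
  have hneg1 : ν (-1) = 0 := by
    have h := hνmul (-1) (-1)
    have h1 : ν (-1) ≠ ⊥ := by simp [hν0]
    obtain ⟨x, hx⟩ := WithBot.ne_bot_iff_exists.1 h1
    rw [neg_mul_neg, mul_one, hne1, ← hx] at h
    rw [← hx]
    norm_cast at h ⊢
    linarith
  have hneg : ∀ x, ν (-x) = ν x := by
    intro x
    rw [← neg_one_mul, hνmul, hneg1, zero_add]
  have hpm : ∀ x y, (x = y ∨ x = -y) → ν x = ν y := by
    rintro x y (h | h) <;> simp [h, hneg]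
  have hmix : ∀ σ S, ν (mixMat B σ S).det = (w S : WithBot ℝ) := by
    intro σ S
    rw [hpm _ _ (mix_det B σ S)]
    rcases S.eq_empty_or_nonempty with h | h
    · subst h
      have hd : subDet B (Finset.map σ.toEmbedding ∅) ∅ = 1 := by
        unfold subDet
        rw [dif_pos (by simp)]
        exact Matrix.det_isEmpty (n := Fin 0)
      rw [hd, hne1, hw0]
      rfl
    · exact hw S h _ (Finset.card_map _)
  have hsub : ∀ (M : Matrix (Fin n) (Fin n) K) (τ : Equiv.Perm (Fin n)) S,
      M = (mixMat B τ S).submatrix id τ → ν M.det = (w S : WithBot ℝ) := by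
    intro M τ S h
    rw [h, hpm _ _ (det_pm' _ _), hmix]
  intro S T i hiS hiT
  have hP := plucker (mixMat B 1 S) (mixMat B 1 T) i
  have hL : ν ((mixMat B 1 S).det * (mixMat B 1 T).det) = ((w S + w T : ℝ) : WithBot ℝ) := by
    rw [hνmul, hmix, hmix]; rfl
  have hLne : (mixMat B 1 S).det * (mixMat B 1 T).det ≠ 0 := by
    intro h
    rw [← hν0, hL] at h
    exact WithBot.coe_ne_bot h
  rw [hP] at hL hLne
  obtain ⟨k, -, hk⟩ := val_sum ν hν0 hνadd _ _ hLne
  rw [hL, hνmul] at hk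
  by_cases hkT : k ∈ T
  · have hik : i ≠ k := fun h => hiT (h ▸ hkT)
    by_cases hkS : k ∈ S
    · exfalso
      have : ((mixMat B 1 S).updateCol i (fun r => mixMat B 1 T r k)).det = 0 := by
        apply Matrix.det_zero_of_column_eq hik
        intro r
        simp [Matrix.updateCol_apply, hik.symm, mixMat, hkS, hkT]
      rw [this, (hν0 0).2 rfl, WithBot.bot_add] at hk
      exact WithBot.coe_ne_bot (le_bot_iff.1 hk)
    · right
      refine ⟨k, hkT, hkS, ?_⟩
      rw [hsub _ (Equiv.swap i k) (insert k (S.erase i)), hsub _ (Equiv.swap i k) ((insert i T).erase k)] at hk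
      · exact_mod_cast hk
      · ext r c
        simp only [Matrix.updateCol_apply, mixMat, Matrix.submatrix_apply, Matrix.of_apply, id,
          Equiv.swap_apply_def, Equiv.Perm.one_apply]
        grind
      · ext r c
        simp only [Matrix.updateCol_apply, mixMat, Matrix.submatrix_apply, Matrix.of_apply, id,
          Equiv.swap_apply_def, Equiv.Perm.one_apply]
        grind
  · by_cases hkS : k ∈ S
    · left
      rw [show ((mixMat B 1 S).updateCol i (fun r => mixMat B 1 T r k)) =
        mixMat B (Equiv.swap i k) (S.erase i) from ?_, hmix,
        hsub _ (Equiv.swap i k) (insert i T)] at hk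
      · exact_mod_cast hk
      · ext r c
        simp only [Matrix.updateCol_apply, mixMat, Matrix.submatrix_apply, Matrix.of_apply, id,
          Equiv.swap_apply_def, Equiv.Perm.one_apply]
        grind
      · ext r c
        simp only [Matrix.updateCol_apply, mixMat, Matrix.of_apply,
          Equiv.swap_apply_def, Equiv.Perm.one_apply]
        grind
    · exfalso
      have hik : i ≠ k := fun h => hkS (h ▸ hiS)
      have : ((mixMat B 1 S).updateCol i (fun r => mixMat B 1 T r k)).det = 0 := by
        apply Matrix.det_zero_of_column_eq hik
        intro r
        simp [Matrix.updateCol_apply, hik.symm, mixMat, hkS, hkT]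
      rw [this, (hν0 0).2 rfl, WithBot.bot_add] at hk
      exact WithBot.coe_ne_bot (le_bot_iff.1 hk)
end
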